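/- arXiv:0811.1173 — 2 statements merged into one kernel-verified Lean document; each statement's English description precedes it below -/
import Mathlib

section
/- There exists a complete C^1 vector field ξ on [0,∞) with ξ(x)=0 if and only if x=0, and a Cantor set K ⊂ ℝ∖ℚ (a nonempty compact, perfect, totally disconnected set of irrational numbers), such that, denoting by f^t the time-t flow of ξ: the map f^{1/2} is not twice continuously differentiable at 0, while f^t is a C^∞ diffeomorphism of [0,∞) for every t in the additive subgroup ℤ ⊕ Σ_{τ∈K} τℤ of ℝ generated by 1 and the elements of K. -/
open Set Filter Topology

/-- `f` is a diffeomorphism of the half-line `[0,∞)`: it fixes `0`, maps `[0,∞)` bijectively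
onto itself, is differentiable (in the sense of `[0,∞)`) with everywhere positive derivative,
and its inverse is differentiable. -/
def HalfLineDiffeo (f : ℝ → ℝ) : Prop :=
  f 0 = 0 ∧ Set.BijOn f (Set.Ici 0) (Set.Ici 0) ∧
    (∀ x ∈ Set.Ici (0 : ℝ), ∃ d : ℝ, 0 < d ∧ HasDerivWithinAt f d (Set.Ici 0) x) ∧
    (∀ y ∈ Set.Ici (0 : ℝ), ∃ d : ℝ,
      HasDerivWithinAt (Function.invFunOn f (Set.Ici 0)) d (Set.Ici 0) y)

/-- `f` is a `C^r` diffeomorphism of `[0,∞)`. -/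
def CrHalfLineDiffeo (r : ℕ∞) (f : ℝ → ℝ) : Prop :=
  HalfLineDiffeo f ∧ ContDiffOn ℝ r f (Set.Ici 0)

/-- The `C^r` centralizer of `f` : all `C^r` diffeomorphisms of `[0,∞)` commuting with `f`. -/
def Centralizer (r : ℕ∞) (f : ℝ → ℝ) : Set (ℝ → ℝ) :=
  {g | CrHalfLineDiffeo r g ∧ ∀ x ∈ Set.Ici (0 : ℝ), g (f x) = f (g x)}

/-- `F` is the (complete, globally defined) flow of the vector field `ξ` on `[0,∞)`:
`F 0 x = x` and `∂ₜ F t x = ξ (F t x)` for all `t ∈ ℝ` and `x ∈ [0,∞)`. -/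
def IsFlowOf (ξ : ℝ → ℝ) (F : ℝ → ℝ → ℝ) : Prop :=
  ∀ x ∈ Set.Ici (0 : ℝ), F 0 x = x ∧
    ∀ t : ℝ, F t x ∈ Set.Ici (0 : ℝ) ∧ HasDerivAt (fun s => F s x) (ξ (F t x)) t

open scoped ContDiff

/-- A function vanishing on the closed negative half-line, smooth on the open positive half-line,
whose first `n` derivatives tend to `0` at `0` from the right, is of class `C^n`. -/
theorem contDiff_of_tendsto_iteratedDeriv (n : ℕ) (g : ℝ → ℝ) (hneg : ∀ x ≤ 0, g x = 0)
    (hg : ContDiffOn ℝ ∞ g (Ioi 0))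
    (hlim : ∀ j ≤ n, Tendsto (iteratedDeriv j g) (𝓝[>] 0) (𝓝 0)) : ContDiff ℝ n g := by
  induction n generalizing g with
  | zero =>
    have h0 := hlim 0 le_rfl
    rw [iteratedDeriv_zero] at h0
    rw [Nat.cast_zero, contDiff_zero, continuous_iff_continuousAt]
    intro x
    rcases lt_trichotomy x 0 with hx | rfl | hx
    · have : g =ᶠ[𝓝 x] fun _ => 0 := by
        filter_upwards [Iio_mem_nhds hx] with y hy using hneg y (le_of_lt hy)
      exact this.continuousAt
    · rw [continuousAt_iff_continuous_left'_right']
      refine ⟨?_, ?_⟩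
      · rw [ContinuousWithinAt, hneg 0 le_rfl]
        refine tendsto_const_nhds.congr' ?_
        filter_upwards [self_mem_nhdsWithin] with y hy using (hneg y (le_of_lt hy)).symm
      · rwa [ContinuousWithinAt, hneg 0 le_rfl]
    · exact (hg.continuousOn.continuousAt (Ioi_mem_nhds hx))
  | succ n ih =>
    have hd : ∀ x, 0 < x → DifferentiableAt ℝ g x := fun x hx =>
      (hg.contDiffAt (Ioi_mem_nhds hx)).differentiableAt (by simp)
    have hder0 : HasDerivAt g 0 0 := by
      rw [← hasDerivWithinAt_univ, ← Iic_union_Ici (a := (0:ℝ))]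
      refine HasDerivWithinAt.union ?_ ?_
      · exact (hasDerivWithinAt_const (0:ℝ) (Iic 0) (0:ℝ)).congr (fun y hy => hneg y hy)
          (hneg 0 le_rfl)
      · refine hasDerivWithinAt_Ici_of_tendsto_deriv (s := Ioi 0)
          (fun x hx => (hd x hx).differentiableWithinAt) ?_ self_mem_nhdsWithin ?_
        · have h0 := hlim 0 (Nat.zero_le _)
          rw [iteratedDeriv_zero] at h0
          rwa [ContinuousWithinAt, hneg 0 le_rfl]
        · have h0 := hlim 1 (by omega)
          rwa [iteratedDeriv_one] at h0
    have hderneg : ∀ x < 0, HasDerivAt g 0 x := fun x hx => by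
      have : g =ᶠ[𝓝 x] fun _ => 0 := by
        filter_upwards [Iio_mem_nhds hx] with y hy using hneg y (le_of_lt hy)
      exact (hasDerivAt_const x (0:ℝ)).congr_of_eventuallyEq this
    rw [Nat.cast_add, Nat.cast_one, contDiff_succ_iff_deriv]
    refine ⟨fun x => ?_, by simp, ih (deriv g) (fun x hx => ?_) ?_ (fun j hj => ?_)⟩
    · rcases lt_trichotomy x 0 with hx | rfl | hx
      · exact (hderneg x hx).differentiableAt
      · exact hder0.differentiableAt
      · exact hd x hx
    · rcases hx.lt_or_eq with hx | rfl
      · exact (hderneg x hx).deriv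
      · exact hder0.deriv
    · exact ((contDiffOn_infty_iff_deriv_of_isOpen isOpen_Ioi).1 hg).2
    · have := hlim (j+1) (by omega)
      rwa [iteratedDeriv_succ'] at this

/-- A smooth function vanishing on the closed negative half-line is flat at `0`. -/
theorem tendsto_iteratedDeriv_of_eq_zero {g : ℝ → ℝ} (hg : ContDiff ℝ ∞ g)
    (hneg : ∀ x ≤ 0, g x = 0) (j : ℕ) : Tendsto (iteratedDeriv j g) (𝓝 0) (𝓝 0) := by
  have hc : Continuous (iteratedDeriv j g) := hg.continuous_iteratedDeriv j (by
    exact_mod_cast le_top)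
  have h0 : iteratedDeriv j g 0 = 0 := by
    have h1 : Tendsto (iteratedDeriv j g) (𝓝[<] 0) (𝓝 (iteratedDeriv j g 0)) :=
      hc.continuousAt.tendsto.mono_left nhdsWithin_le_nhds
    refine tendsto_nhds_unique h1 (tendsto_const_nhds.congr' ?_)
    filter_upwards [self_mem_nhdsWithin] with y hy
    have : g =ᶠ[𝓝 y] fun _ => 0 := by
      filter_upwards [Iio_mem_nhds hy] with z hz using hneg z (le_of_lt hz)
    rw [this.iteratedDeriv_eq]
    simp
  have := hc.tendsto 0
  rwa [h0] at this

section Partial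

variable {P : Type*} [NormedAddCommGroup P] [NormedSpace ℝ P]

/-- The iterated partial derivative of `H : P × ℝ → ℝ` in the second variable. -/
noncomputable def partialSnd (H : P × ℝ → ℝ) : ℕ → P × ℝ → ℝ
  | 0 => H
  | j + 1 => fun p => fderiv ℝ (partialSnd H j) p (0, 1)

theorem ContDiffOn.fderiv_apply_of_isOpen {H : P × ℝ → ℝ} {U : Set (P × ℝ)} (hU : IsOpen U)
    (hH : ContDiffOn ℝ ∞ H U) (v : P × ℝ) : ContDiffOn ℝ ∞ (fun p => fderiv ℝ H p v) U :=
  (hH.fderiv_of_isOpen hU (m := ∞) (by simp)).clm_apply contDiffOn_const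

theorem contDiffOn_partialSnd {H : P × ℝ → ℝ} {U : Set (P × ℝ)} (hU : IsOpen U)
    (hH : ContDiffOn ℝ ∞ H U) (j : ℕ) : ContDiffOn ℝ ∞ (partialSnd H j) U := by
  induction j with
  | zero => exact hH
  | succ j ih => exact ih.fderiv_apply_of_isOpen hU _

theorem iteratedDeriv_eq_partialSnd {H : P × ℝ → ℝ} {U : Set (P × ℝ)} (hU : IsOpen U)
    (hH : ContDiffOn ℝ ∞ H U) (j : ℕ) {a : P} {x : ℝ} (hx : (a, x) ∈ U) :
    iteratedDeriv j (fun y => H (a, y)) x = partialSnd H j (a, x) := by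
  induction j generalizing x with
  | zero => rfl
  | succ j ih =>
    rw [iteratedDeriv_succ]
    have hev : iteratedDeriv j (fun y => H (a, y)) =ᶠ[𝓝 x] fun y => partialSnd H j (a, y) := by
      have : ∀ᶠ y in 𝓝 x, (a, y) ∈ U :=
        (Continuous.prodMk_right a).continuousAt.eventually_mem (hU.mem_nhds hx)
      filter_upwards [this] with y hy using ih hy
    rw [hev.deriv_eq]
    have hd : DifferentiableAt ℝ (partialSnd H j) (a, x) :=
      ((contDiffOn_partialSnd hU hH j).contDiffAt (hU.mem_nhds hx)).differentiableAt (by simp)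
    have hl : HasDerivAt (fun y : ℝ => ((a, y) : P × ℝ)) (0, 1) x :=
      (hasDerivAt_const x a).prodMk (hasDerivAt_id x)
    exact (hd.hasFDerivAt.comp_hasDerivAt x hl).deriv

theorem continuousOn_iteratedDeriv_param {H : P × ℝ → ℝ} {U : Set (P × ℝ)} (hU : IsOpen U)
    (hH : ContDiffOn ℝ ∞ H U) (j : ℕ) :
    ContinuousOn (fun p : P × ℝ => iteratedDeriv j (fun y => H (p.1, y)) p.2) U :=
  (contDiffOn_partialSnd hU hH j).continuousOn.congr
    fun p hp => iteratedDeriv_eq_partialSnd hU hH j (a := p.1) (x := p.2) hp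

theorem fderiv_partialSnd_comm {H : P × ℝ → ℝ} {U : Set (P × ℝ)} (hU : IsOpen U)
    (hH : ContDiffOn ℝ ∞ H U) (v : P × ℝ) (j : ℕ) {p : P × ℝ} (hp : p ∈ U) :
    fderiv ℝ (partialSnd H j) p v = partialSnd (fun p => fderiv ℝ H p v) j p := by
  induction j generalizing p with
  | zero => rfl
  | succ j ih =>
    have hs := contDiffOn_partialSnd hU hH j
    have hsp := hs.contDiffAt (hU.mem_nhds hp)
    have hsymm : IsSymmSndFDerivAt ℝ (partialSnd H j) p :=
      hsp.isSymmSndFDerivAt (by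
        simpa using WithTop.coe_le_coe.2 (le_top : (2 : ℕ∞) ≤ ⊤))
    have hdd : DifferentiableAt ℝ (fderiv ℝ (partialSnd H j)) p :=
      ((hs.fderiv_of_isOpen hU (m := ∞) (by simp)).contDiffAt
        (hU.mem_nhds hp)).differentiableAt (by simp)
    have e1 : ∀ w u : P × ℝ, fderiv ℝ (fun p => fderiv ℝ (partialSnd H j) p w) p u
        = fderiv ℝ (fderiv ℝ (partialSnd H j)) p u w := by
      intro w u
      rw [(hdd.hasFDerivAt.clm_apply (hasFDerivAt_const w p)).fderiv]
      simp
    have hev : (fun p => fderiv ℝ (partialSnd H j) p v)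
        =ᶠ[𝓝 p] partialSnd (fun p => fderiv ℝ H p v) j := by
      filter_upwards [hU.mem_nhds hp] with y hy using ih hy
    change fderiv ℝ (fun p => fderiv ℝ (partialSnd H j) p (0, 1)) p v =
      fderiv ℝ (partialSnd (fun p => fderiv ℝ H p v) j) p (0, 1)
    rw [← hev.fderiv_eq, e1, e1]
    exact hsymm v (0, 1)

end Partial

/-- Differentiation in a real parameter commutes with iterated differentiation in the other
variable. -/
theorem hasDerivAt_iteratedDeriv_param {H H' : ℝ × ℝ → ℝ} {U : Set (ℝ × ℝ)} (hU : IsOpen U)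
    (hH : ContDiffOn ℝ ∞ H U)
    (hH' : ∀ p ∈ U, HasDerivAt (fun t => H (t, p.2)) (H' p) p.1) (j : ℕ) {t x : ℝ}
    (hp : (t, x) ∈ U) :
    HasDerivAt (fun s => iteratedDeriv j (fun y => H (s, y)) x)
      (iteratedDeriv j (fun y => H' (t, y)) x) t := by
  have hfd : ∀ G : ℝ × ℝ → ℝ, ContDiffOn ℝ ∞ G U → ∀ p ∈ U,
      HasDerivAt (fun t => G (t, p.2)) (fderiv ℝ G p (1, 0)) p.1 := by
    intro G hG p hp
    have hd : DifferentiableAt ℝ G (p.1, p.2) :=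
      (hG.contDiffAt (hU.mem_nhds hp)).differentiableAt (by simp)
    have hl : HasDerivAt (fun s : ℝ => ((s, p.2) : ℝ × ℝ)) (1, 0) p.1 :=
      (hasDerivAt_id p.1).prodMk (hasDerivAt_const p.1 p.2)
    exact hd.hasFDerivAt.comp_hasDerivAt p.1 hl
  have hG' : ContDiffOn ℝ ∞ (fun p => fderiv ℝ H p (1, 0)) U := hH.fderiv_apply_of_isOpen hU _
  have heq : ∀ p ∈ U, H' p = fderiv ℝ H p (1, 0) := fun p hp =>
    (hH' p hp).unique (hfd H hH p hp)
  have e1 : iteratedDeriv j (fun y => H' (t, y)) x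
      = iteratedDeriv j (fun y => fderiv ℝ H (t, y) (1, 0)) x := by
    apply Filter.EventuallyEq.iteratedDeriv_eq
    have : ∀ᶠ y in 𝓝 x, (t, y) ∈ U :=
      (Continuous.prodMk_right t).continuousAt.eventually_mem (hU.mem_nhds hp)
    filter_upwards [this] with y hy using heq _ hy
  rw [e1, iteratedDeriv_eq_partialSnd (H := fun p => fderiv ℝ H p (1, 0)) hU hG' j hp,
    ← fderiv_partialSnd_comm hU hH (1, 0) j hp]
  refine (hfd _ (contDiffOn_partialSnd hU hH j) _ hp).congr_of_eventuallyEq ?_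
  have : ∀ᶠ s in 𝓝 t, (s, x) ∈ U :=
    (Continuous.prodMk_left x).continuousAt.eventually_mem (hU.mem_nhds hp)
  filter_upwards [this] with s hs using iteratedDeriv_eq_partialSnd hU hH j hs

/-- Faà di Bruno bound for iterated derivatives of a composition on open sets of the line. -/
theorem abs_iteratedDeriv_comp_le {g f : ℝ → ℝ} {s t : Set ℝ} (hs : IsOpen s) (ht : IsOpen t)
    (hg : ContDiffOn ℝ ∞ g t) (hf : ContDiffOn ℝ ∞ f s) (hst : MapsTo f s t) {x : ℝ} (hx : x ∈ s)
    {n : ℕ} {C D : ℝ} (hC : ∀ i ≤ n, |iteratedDeriv i g (f x)| ≤ C)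
    (hD : ∀ i, 1 ≤ i → i ≤ n → |iteratedDeriv i f x| ≤ D ^ i) :
    |iteratedDeriv n (fun y => g (f y)) x| ≤ n.factorial * C * D ^ n := by
  have key := norm_iteratedFDerivWithin_comp_le (n := n) hg hf (by exact_mod_cast le_top)
    ht.uniqueDiffOn hs.uniqueDiffOn hst hx (C := C) (D := D)
  simp only [iteratedFDerivWithin_of_isOpen _ hs hx,
    iteratedFDerivWithin_of_isOpen _ ht (hst hx), norm_iteratedFDeriv_eq_norm_iteratedDeriv,
    Real.norm_eq_abs] at key
  exact key hC hD

/-- `S` is a time coordinate for the positive vector field `ξ` on `(0,∞)`: a smooth bijection onto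
the line with `S' = 1/ξ`. -/
structure TimeChart (ξ S : ℝ → ℝ) : Prop where
  smooth : ContDiffOn ℝ ∞ S (Ioi 0)
  pos : ∀ x, 0 < x → 0 < ξ x
  hasDerivAt : ∀ x, 0 < x → HasDerivAt S (ξ x)⁻¹ x
  surj : ∀ s, ∃ x, 0 < x ∧ S x = s

/-- The flow with time coordinate `S`. -/
noncomputable def chartFlow (S : ℝ → ℝ) (t x : ℝ) : ℝ :=
  if 0 < x then Function.invFunOn S (Ioi 0) (S x + t) else x

namespace TimeChart

variable {ξ S : ℝ → ℝ}

theorem strictMonoOn (h : TimeChart ξ S) : StrictMonoOn S (Ioi 0) := by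
  refine strictMonoOn_of_deriv_pos (convex_Ioi 0) h.smooth.continuousOn fun x hx => ?_
  rw [interior_Ioi] at hx
  rw [(h.hasDerivAt x hx).deriv]
  exact inv_pos.2 (h.pos x hx)

theorem inv_pos' (h : TimeChart ξ S) (s : ℝ) : 0 < Function.invFunOn S (Ioi 0) s := by
  obtain ⟨x, hx, hs⟩ := h.surj s
  exact Function.invFunOn_mem (s := Ioi 0) ⟨x, hx, hs⟩

theorem chart_inv (h : TimeChart ξ S) (s : ℝ) : S (Function.invFunOn S (Ioi 0) s) = s := by
  obtain ⟨x, hx, hs⟩ := h.surj s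
  exact Function.invFunOn_eq (s := Ioi 0) ⟨x, hx, hs⟩

theorem inv_chart (h : TimeChart ξ S) {x : ℝ} (hx : 0 < x) :
    Function.invFunOn S (Ioi 0) (S x) = x :=
  h.strictMonoOn.injOn (h.inv_pos' _) hx (h.chart_inv _)

theorem contDiff_inv (h : TimeChart ξ S) : ContDiff ℝ ∞ (Function.invFunOn S (Ioi 0)) := by
  rw [contDiff_iff_contDiffAt]
  intro s
  obtain ⟨x, hx, rfl⟩ := h.surj s
  have hS : ContDiffAt ℝ ∞ S x := h.smooth.contDiffAt (Ioi_mem_nhds hx)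
  have hne : (ξ x)⁻¹ ≠ 0 := (inv_pos.2 (h.pos x hx)).ne'
  have hf : HasFDerivAt S
      ((ContinuousLinearEquiv.unitsEquivAut ℝ (Units.mk0 _ hne) : ℝ ≃L[ℝ] ℝ) : ℝ →L[ℝ] ℝ) x := by
    exact (h.hasDerivAt x hx).hasFDerivAt_equiv hne
  have hloc := hS.to_localInverse hf (by simp)
  refine hloc.congr_of_eventuallyEq ?_
  set g := hS.localInverse hf (by simp) with hg
  have hst := hS.hasStrictFDerivAt' hf (by simp)
  have hr : ∀ᶠ y in 𝓝 (S x), S (g y) = y := hst.eventually_right_inverse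
  have hgx : g (S x) = x := hst.localInverse_apply_image
  have hgpos : ∀ᶠ y in 𝓝 (S x), 0 < g y := by
    have := hloc.continuousAt.tendsto
    rw [hgx] at this
    exact this.eventually (Ioi_mem_nhds hx)
  filter_upwards [hr, hgpos] with y hy hy'
  exact h.strictMonoOn.injOn (h.inv_pos' _) hy' (by rw [h.chart_inv, hy])

theorem contDiffOn_field (h : TimeChart ξ S) : ContDiffOn ℝ ∞ ξ (Ioi 0) := by
  have h1 := ((contDiffOn_infty_iff_deriv_of_isOpen isOpen_Ioi).1 h.smooth).2
  have h2 : ContDiffOn ℝ ∞ (fun x => (deriv S x)⁻¹) (Ioi 0) := h1.inv fun x hx => by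
    rw [(h.hasDerivAt x hx).deriv]
    exact (inv_pos.2 (h.pos x hx)).ne'
  exact h2.congr fun x hx => by rw [(h.hasDerivAt x hx).deriv, inv_inv]

theorem hasDerivAt_inv (h : TimeChart ξ S) (s : ℝ) :
    HasDerivAt (Function.invFunOn S (Ioi 0)) (ξ (Function.invFunOn S (Ioi 0) s)) s := by
  have h1 := HasDerivAt.of_local_left_inverse (f := S) (g := Function.invFunOn S (Ioi 0)) (a := s)
    h.contDiff_inv.continuous.continuousAt (h.hasDerivAt _ (h.inv_pos' s))
    (inv_pos.2 (h.pos _ (h.inv_pos' s))).ne' (Eventually.of_forall h.chart_inv)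
  rwa [inv_inv] at h1

theorem flow_of_pos {x : ℝ} (hx : 0 < x) (t : ℝ) :
    chartFlow S t x = Function.invFunOn S (Ioi 0) (S x + t) := if_pos hx

theorem flow_of_nonpos {x : ℝ} (hx : x ≤ 0) (t : ℝ) : chartFlow S t x = x := if_neg hx.not_gt

theorem flow_pos (h : TimeChart ξ S) {x : ℝ} (hx : 0 < x) (t : ℝ) : 0 < chartFlow S t x := by
  rw [flow_of_pos hx]; exact h.inv_pos' _

theorem chart_flow (h : TimeChart ξ S) {x : ℝ} (hx : 0 < x) (t : ℝ) :
    S (chartFlow S t x) = S x + t := by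
  rw [flow_of_pos hx, h.chart_inv]

theorem flow_eq (h : TimeChart ξ S) {x y t : ℝ} (hx : 0 < x) (hy : 0 < y) (hS : S y = S x + t) :
    chartFlow S t x = y := by
  rw [flow_of_pos hx, ← hS, h.inv_chart hy]

theorem flow_zero (h : TimeChart ξ S) (x : ℝ) : chartFlow S 0 x = x := by
  by_cases hx : 0 < x
  · exact h.flow_eq hx hx (by simp)
  · exact flow_of_nonpos (not_lt.1 hx) _

theorem flow_add (h : TimeChart ξ S) (s t x : ℝ) :
    chartFlow S (s + t) x = chartFlow S s (chartFlow S t x) := by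
  by_cases hx : 0 < x
  · refine h.flow_eq hx (h.flow_pos (h.flow_pos hx _) _) ?_
    rw [h.chart_flow (h.flow_pos hx _), h.chart_flow hx]; ring
  · rw [flow_of_nonpos (not_lt.1 hx), flow_of_nonpos (not_lt.1 hx), flow_of_nonpos (not_lt.1 hx)]

theorem flow_nonneg (h : TimeChart ξ S) {x : ℝ} (hx : 0 ≤ x) (t : ℝ) : 0 ≤ chartFlow S t x := by
  rcases hx.lt_or_eq with hx | rfl
  · exact (h.flow_pos hx t).le
  · rw [flow_of_nonpos le_rfl]

theorem hasDerivAt_flow_time (h : TimeChart ξ S) {x : ℝ} (hx : 0 < x) (t : ℝ) :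
    HasDerivAt (fun s => chartFlow S s x) (ξ (chartFlow S t x)) t := by
  simp only [flow_of_pos hx]
  have := (h.hasDerivAt_inv (S x + t)).comp_const_add (S x) t
  exact this

theorem hasDerivAt_flow (h : TimeChart ξ S) {x : ℝ} (hx : 0 < x) (t : ℝ) :
    HasDerivAt (chartFlow S t) (ξ (chartFlow S t x) / ξ x) x := by
  have h1 : HasDerivAt (fun y => Function.invFunOn S (Ioi 0) (S y + t))
      (ξ (Function.invFunOn S (Ioi 0) (S x + t)) * (ξ x)⁻¹) x :=
    HasDerivAt.comp x (h₂ := Function.invFunOn S (Ioi 0)) (h := fun y => S y + t)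
      (h.hasDerivAt_inv (S x + t)) ((h.hasDerivAt x hx).add_const t)
  rw [flow_of_pos hx, div_eq_mul_inv]
  refine h1.congr_of_eventuallyEq ?_
  filter_upwards [Ioi_mem_nhds hx] with y hy using flow_of_pos hy t

theorem contDiffOn_flow_prod (h : TimeChart ξ S) :
    ContDiffOn ℝ ∞ (fun p : ℝ × ℝ => chartFlow S p.1 p.2) (univ ×ˢ Ioi 0) := by
  have h1 : ContDiffOn ℝ ∞ (fun p : ℝ × ℝ => S p.2 + p.1) (univ ×ˢ Ioi 0) :=
    (h.smooth.comp contDiffOn_snd fun p hp => hp.2).add contDiffOn_fst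
  exact (h.contDiff_inv.comp_contDiffOn h1).congr fun p hp => flow_of_pos hp.2 _

theorem contDiffOn_flow (h : TimeChart ξ S) (t : ℝ) : ContDiffOn ℝ ∞ (chartFlow S t) (Ioi 0) := by
  have h1 : ContDiffOn ℝ ∞ (fun x : ℝ => (t, x)) (Ioi 0) :=
    contDiffOn_const.prodMk contDiffOn_id
  exact h.contDiffOn_flow_prod.comp h1 fun x hx => ⟨mem_univ _, hx⟩

theorem hasDerivAt_iteratedDeriv_flow (h : TimeChart ξ S) (j : ℕ) {x : ℝ} (hx : 0 < x) (t : ℝ) :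
    HasDerivAt (fun s => iteratedDeriv j (chartFlow S s) x)
      (iteratedDeriv j (fun y => ξ (chartFlow S t y)) x) t :=
  hasDerivAt_iteratedDeriv_param (H := fun p => chartFlow S p.1 p.2)
    (H' := fun p => ξ (chartFlow S p.1 p.2)) (isOpen_univ.prod isOpen_Ioi) h.contDiffOn_flow_prod
    (fun p hp => h.hasDerivAt_flow_time hp.2 p.1) j ⟨mem_univ _, hx⟩

end TimeChart

theorem abs_iteratedDeriv_id_le {j : ℕ} (hj : 1 ≤ j) (x : ℝ) :
    |iteratedDeriv j (fun y : ℝ => y) x| ≤ 1 := by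
  obtain ⟨i, rfl⟩ := Nat.exists_eq_add_of_le' hj
  rw [iteratedDeriv_succ']
  have : deriv (fun y : ℝ => y) = fun _ => 1 := by ext y; simp
  rw [this, iteratedDeriv_const]
  split_ifs <;> simp

/-- If the first `K` derivatives of the vector field are small along the orbit segment of `x`, then
the flow is `C^K`-close to the identity at `x`. -/
theorem TimeChart.abs_iteratedDeriv_flow_sub_le {ξ S : ℝ → ℝ} (h : TimeChart ξ S) {K : ℕ}
    {x T η δ : ℝ} (hx : 0 < x) (hT : 0 < T) (hδ : δ ≤ 1)
    (hη : η * K.factorial * 2 ^ K * T < δ)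
    (hξ : ∀ r, |r| ≤ T → ∀ j ≤ K, |iteratedDeriv j ξ (chartFlow S r x)| ≤ η) {t : ℝ}
    (ht : |t| ≤ T) {j : ℕ} (hj : j ≤ K) :
    |iteratedDeriv j (fun y => chartFlow S t y - y) x| ≤ δ := by
  have hη0 : 0 ≤ η := (abs_nonneg _).trans (hξ 0 (by simpa using hT.le) 0 (Nat.zero_le _))
  have hid : ∀ i : ℕ, iteratedDeriv i (chartFlow S 0) x = iteratedDeriv i (fun y => y) x := by
    intro i
    have : chartFlow S 0 = fun y => y := funext h.flow_zero
    rw [this]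
  have key : ∀ σ : ℝ, |σ| = 1 → ∀ s ∈ Icc 0 T, ∀ i ≤ K,
      |iteratedDeriv i (chartFlow S (σ * s)) x - iteratedDeriv i (fun y => y) x| ≤ δ / T * s := by
    intro σ hσ s hs i hi
    let f : ℝ → (Fin (K + 1) → ℝ) := fun s i =>
      iteratedDeriv i (chartFlow S (σ * s)) x - iteratedDeriv i (fun y => y) x
    let f' : ℝ → (Fin (K + 1) → ℝ) := fun s i =>
      σ * iteratedDeriv i (fun y => ξ (chartFlow S (σ * s) y)) x
    have hff : ∀ s, HasDerivAt f (f' s) s := by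
      intro s
      rw [hasDerivAt_pi]
      intro i
      have h1 := h.hasDerivAt_iteratedDeriv_flow i hx (σ * s)
      have h2 : HasDerivAt (fun s => σ * s) σ s := by
        simpa using (hasDerivAt_id s).const_mul σ
      have := (h1.comp s h2).sub_const (iteratedDeriv i (fun y => y) x)
      rw [mul_comm] at this
      exact this
    have hbd := image_norm_le_of_norm_deriv_right_lt_deriv_boundary' (f := f) (f' := f') (a := 0)
      (b := T) (B := fun s => δ / T * s) (B' := fun _ => δ / T)
      (fun s _ => (hff s).continuousAt.continuousWithinAt)
      (fun s _ => (hff s).hasDerivWithinAt) ?_ (by fun_prop)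
      (fun s _ => by
        simpa using ((hasDerivAt_id s).const_mul (δ / T)).hasDerivWithinAt) ?_ hs
    · have h1 := (norm_le_pi_norm (f s) ⟨i, Nat.lt_succ_of_le hi⟩).trans hbd
      simpa [f] using h1
    · have : f 0 = 0 := by
        ext i
        simp only [f, mul_zero, Pi.zero_apply, hid, sub_self]
      simp [this]
    · intro s hs hfs
      have hs1 : δ / T * s ≤ 1 := by
        rw [div_mul_eq_mul_div, div_le_one hT]
        have hδ0 : 0 ≤ δ := le_of_lt (lt_of_le_of_lt (by positivity) hη)
        nlinarith [hs.1, hs.2]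
      have hD : ∀ i, 1 ≤ i → i ≤ K → |iteratedDeriv i (chartFlow S (σ * s)) x| ≤ 2 ^ i := by
        intro i hi1 hi2
        have h1 := norm_le_pi_norm (f s) ⟨i, Nat.lt_succ_of_le hi2⟩
        rw [hfs] at h1
        have h2 : |iteratedDeriv i (chartFlow S (σ * s)) x - iteratedDeriv i (fun y => y) x|
          ≤ 1 := h1.trans hs1
        have h3 := abs_iteratedDeriv_id_le hi1 x
        have h4 : (2:ℝ) ≤ 2 ^ i := by
          calc (2:ℝ) = 2 ^ 1 := by norm_num
            _ ≤ 2 ^ i := pow_le_pow_right₀ (by norm_num) hi1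
        rw [abs_le] at *
        constructor <;> linarith
      have hrs : |σ * s| ≤ T := by
        rw [abs_mul, hσ, one_mul, abs_of_nonneg hs.1]; exact hs.2.le
      have hlt : η * K.factorial * 2 ^ K < δ / T := by rwa [lt_div_iff₀ hT]
      refine lt_of_le_of_lt ?_ hlt
      rw [pi_norm_le_iff_of_nonneg (by positivity)]
      intro i
      have hiK : (i : ℕ) ≤ K := Nat.lt_succ_iff.1 i.2
      have h1 := abs_iteratedDeriv_comp_le (n := i) (C := η) (D := 2) isOpen_Ioi isOpen_Ioi
        h.contDiffOn_field (h.contDiffOn_flow (σ * s)) (fun y hy => h.flow_pos hy _)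
        (mem_Ioi.2 hx) (fun j hj => hξ _ hrs j (hj.trans hiK))
        (fun j hj hj' => hD j hj (hj'.trans hiK))
      have h2 : ((i : ℕ).factorial : ℝ) * η * 2 ^ (i : ℕ) ≤ η * K.factorial * 2 ^ K := by
        rw [mul_comm ((i : ℕ).factorial : ℝ) η]
        have : ((i : ℕ).factorial : ℝ) ≤ K.factorial := by
          exact_mod_cast Nat.factorial_le hiK
        have : (2 : ℝ) ^ (i : ℕ) ≤ 2 ^ K := pow_le_pow_right₀ (by norm_num) hiK
        gcongr
      simp only [f', norm_mul, Real.norm_eq_abs, hσ, one_mul]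
      exact h1.trans h2
  have hsub : iteratedDeriv j (fun y => chartFlow S t y - y) x =
      iteratedDeriv j (chartFlow S t) x - iteratedDeriv j (fun y => y) x := by
    apply iteratedDeriv_fun_sub
    · exact ((h.contDiffOn_flow t).contDiffAt (Ioi_mem_nhds hx)).of_le (by exact_mod_cast le_top)
    · exact contDiffAt_id
  have hδ0 : 0 ≤ δ := le_of_lt (lt_of_le_of_lt (by positivity) hη)
  have hle : δ / T * |t| ≤ δ := by
    rw [div_mul_eq_mul_div, div_le_iff₀ hT]
    exact mul_le_mul_of_nonneg_left ht hδ0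
  rw [hsub]
  refine le_trans ?_ hle
  rcases le_total 0 t with h0 | h0
  · rw [abs_of_nonneg h0]
    have := key 1 (by simp) |t| ⟨abs_nonneg _, ht⟩ j hj
    rwa [abs_of_nonneg h0, one_mul] at this
  · rw [abs_of_nonpos h0]
    have := key (-1) (by simp) |t| ⟨abs_nonneg _, ht⟩ j hj
    rwa [abs_of_nonpos h0, neg_one_mul, neg_neg] at this

/-- Orbits of a field with `ξ x = o(x)` move by a small proportion in bounded time. -/
theorem TimeChart.abs_flow_sub_le {ξ S : ℝ → ℝ} (h : TimeChart ξ S) {ρ c κ x T t : ℝ}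
    (hκ : ∀ y, 0 < y → y < ρ → ξ y ≤ κ * y) (hκ0 : 0 < κ) (hc : 0 < c) (hc1 : c < 1)
    (hx : 0 < x) (hxρ : 2 * x ≤ ρ) (hTc : 2 * κ * T ≤ c) (ht : |t| ≤ T) :
    |chartFlow S t x - x| ≤ c * x := by
  have hmvt : ∀ a b, 0 < a → a < b → b < ρ → (b - a) / (κ * b) ≤ S b - S a := by
    intro a b ha hab hb
    obtain ⟨z, hz, hz'⟩ := exists_hasDerivAt_eq_slope S (fun x => (ξ x)⁻¹) hab
      (h.smooth.continuousOn.mono fun y hy => lt_of_lt_of_le ha hy.1)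
      (fun y hy => h.hasDerivAt y (ha.trans hy.1))
    have hz0 : 0 < z := ha.trans hz.1
    rw [eq_div_iff (by linarith)] at hz'
    rw [← hz', mul_comm (ξ z)⁻¹, div_eq_mul_inv]
    have h1 : ξ z ≤ κ * b := (hκ z hz0 (hz.2.trans hb)).trans (by gcongr; exact hz.2.le)
    have h2 := inv_anti₀ (h.pos z hz0) h1
    exact mul_le_mul_of_nonneg_left h2 (by linarith)
  have hy := h.flow_pos hx t
  have hSy := h.chart_flow hx t
  set y := chartFlow S t x
  have htT := abs_le.1 ht
  rw [abs_le]
  constructor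
  · by_contra hcon
    push Not at hcon
    have hz : 0 < x - c * x := by nlinarith
    have hyz : y < x - c * x := by linarith
    have h1 := h.strictMonoOn hy hz hyz
    have h2 := hmvt (x - c * x) x hz (by nlinarith) (by linarith)
    have h3 : T ≤ (x - (x - c * x)) / (κ * x) := by
      rw [le_div_iff₀ (by positivity)]
      nlinarith [mul_le_mul_of_nonneg_right hTc hx.le, mul_pos hc hx]
    linarith
  · by_contra hcon
    push Not at hcon
    have hz : 0 < x + c * x := by positivity
    have hyz : x + c * x < y := by linarith
    have h1 := h.strictMonoOn hz hy hyz
    have h2 := hmvt x (x + c * x) hx (by nlinarith) (by nlinarith)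
    have h3 : T ≤ (x + c * x - x) / (κ * (x + c * x)) := by
      rw [le_div_iff₀ (by positivity)]
      have hT0 : 0 ≤ T := (abs_nonneg _).trans ht
      have : c * x ≤ x := by nlinarith
      have h5 : κ * T * (x + c * x) ≤ κ * T * (2 * x) := by
        gcongr; linarith
      nlinarith [mul_le_mul_of_nonneg_right hTc hx.le]
    linarith

theorem exists_hasDerivAt_inv {E : ℝ → ℝ} {a b : ℝ} (hE : ContinuousOn E (Ioo a b))
    (hpos : ∀ x ∈ Ioo a b, 0 < E x) {m : ℝ} (hm : m ∈ Ioo a b) :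
    ∃ T : ℝ → ℝ, T m = 0 ∧ ∀ x ∈ Ioo a b, HasDerivAt T (E x)⁻¹ x := by
  have hc : ContinuousOn (fun x => (E x)⁻¹) (Ioo a b) := hE.inv₀ fun x hx => (hpos x hx).ne'
  refine ⟨fun x => ∫ y in m..x, (E y)⁻¹, by simp, fun x hx => ?_⟩
  have hsub : uIcc m x ⊆ Ioo a b := ordConnected_Ioo.uIcc_subset hm hx
  exact intervalIntegral.integral_hasDerivAt_right
    ((hc.mono hsub).intervalIntegrable)
    (hc.stronglyMeasurableAtFilter isOpen_Ioo x hx) (hc.continuousAt (isOpen_Ioo.mem_nhds hx))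

theorem contDiffOn_of_hasDerivAt {f f' : ℝ → ℝ} {s : Set ℝ} (hs : IsOpen s)
    (hf : ∀ x ∈ s, HasDerivAt f (f' x) x) (hf' : ContDiffOn ℝ ∞ f' s) : ContDiffOn ℝ ∞ f s := by
  rw [contDiffOn_infty_iff_deriv_of_isOpen hs]
  exact ⟨fun x hx => (hf x hx).differentiableAt.differentiableWithinAt,
    hf'.congr fun x hx => (hf x hx).deriv⟩

theorem eq_add_of_hasDerivAt_eq {f g f' : ℝ → ℝ} {a b : ℝ}
    (hf : ∀ x ∈ Ioo a b, HasDerivAt f (f' x) x) (hg : ∀ x ∈ Ioo a b, HasDerivAt g (f' x) x)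
    {m x : ℝ} (hm : m ∈ Ioo a b) (hx : x ∈ Ioo a b) : f x = g x + (f m - g m) := by
  have := (convex_Ioo a b).is_const_of_fderivWithin_eq_zero (𝕜 := ℝ) (f := fun y => f y - g y)
    (fun y hy => ((hf y hy).sub (hg y hy)).differentiableAt.differentiableWithinAt)
    (fun y hy => by
      rw [fderivWithin_of_isOpen isOpen_Ioo hy]
      have h := ((hf y hy).sub (hg y hy))
      rw [sub_self] at h
      ext
      simpa using (show HasDerivAt (fun y => f y - g y) 0 y from h).deriv) hx hm
  linarith

/-- A time coordinate `A` modified by a localized oscillation of frequency `w`. -/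
noncomputable def twist (χ : ℝ → ℝ) (α w : ℝ) (A : ℝ → ℝ) (x : ℝ) : ℝ :=
  A x + α * (χ x * Real.sin (w * A x))

theorem exists_twist_bound {E χ : ℝ → ℝ} {a b c d : ℝ} (hE : ContDiff ℝ ∞ E)
    (hpos : ∀ x ∈ Ioo a b, 0 < E x) (hχ : ContDiff ℝ ∞ χ) (hac : a < c) (hcd : c ≤ d)
    (hdb : d < b) (w : ℝ) (n : ℕ) {ε : ℝ} (hε : 0 < ε) :
    ∃ α₀ > 0, ∀ α, 0 ≤ α → α ≤ α₀ → ∀ A : ℝ → ℝ, (∀ x ∈ Ioo a b, HasDerivAt A (E x)⁻¹ x) →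
      ∀ x ∈ Icc c d, 0 < deriv (twist χ α w A) x ∧ ∀ j ≤ n,
        |iteratedDeriv j (fun y => (deriv (twist χ α w A) y)⁻¹) x - iteratedDeriv j E x| ≤ ε := by
  have hm : c ∈ Ioo a b := ⟨hac, by linarith⟩
  have hcd' : Icc c d ⊆ Ioo a b := fun x hx => ⟨by linarith [hx.1], by linarith [hx.2]⟩
  obtain ⟨T, -, hT⟩ := exists_hasDerivAt_inv hE.continuous.continuousOn hpos hm
  have hEi : ContDiffOn ℝ ∞ (fun x => (E x)⁻¹) (Ioo a b) :=
    hE.contDiffOn.inv fun x hx => (hpos x hx).ne'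
  have hTs : ContDiffOn ℝ ∞ T (Ioo a b) := contDiffOn_of_hasDerivAt isOpen_Ioo hT hEi
  set P : ℝ → ℝ := fun x => χ x * Real.sin (w * T x) with hP
  set Q : ℝ → ℝ := fun x => χ x * Real.cos (w * T x) with hQ
  have hPs : ContDiffOn ℝ ∞ P (Ioo a b) :=
    hχ.contDiffOn.mul (Real.contDiff_sin.comp_contDiffOn (contDiffOn_const.mul hTs))
  have hQs : ContDiffOn ℝ ∞ Q (Ioo a b) :=
    hχ.contDiffOn.mul (Real.contDiff_cos.comp_contDiffOn (contDiffOn_const.mul hTs))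
  obtain ⟨hPd, hP'⟩ := (contDiffOn_infty_iff_deriv_of_isOpen isOpen_Ioo).1 hPs
  obtain ⟨hQd, hQ'⟩ := (contDiffOn_infty_iff_deriv_of_isOpen isOpen_Ioo).1 hQs
  set D : (ℝ × ℝ) × ℝ → ℝ := fun z => (E z.2)⁻¹ + (z.1.1 * deriv P z.2 + z.1.2 * deriv Q z.2)
    with hD
  set V : Set ((ℝ × ℝ) × ℝ) := univ ×ˢ Ioo a b with hV
  have hVo : IsOpen V := isOpen_univ.prod isOpen_Ioo
  have hsnd : MapsTo (fun z : (ℝ × ℝ) × ℝ => z.2) V (Ioo a b) := fun z hz => hz.2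
  have hDs : ContDiffOn ℝ ∞ D V := by
    refine (hEi.comp contDiffOn_snd hsnd).add (ContDiffOn.add ?_ ?_)
    · exact contDiff_fst.fst.contDiffOn.mul (hP'.comp contDiffOn_snd hsnd)
    · exact contDiff_fst.snd.contDiffOn.mul (hQ'.comp contDiffOn_snd hsnd)
  set U : Set ((ℝ × ℝ) × ℝ) := V ∩ D ⁻¹' Ioi 0 with hU
  have hUo : IsOpen U := hDs.continuousOn.isOpen_inter_preimage hVo isOpen_Ioi
  have hHs : ContDiffOn ℝ ∞ (fun z => (D z)⁻¹) U :=
    (hDs.mono inter_subset_left).inv fun z hz => (show 0 < D z from hz.2).ne'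
  have hev : ∀ᶠ p : ℝ × ℝ in 𝓝 (0, 0), ∀ x ∈ Icc c d, 0 < D (p, x) ∧ ∀ j ∈ Finset.range (n + 1),
      |iteratedDeriv j (fun y => (D (p, y))⁻¹) x - iteratedDeriv j E x| < ε := by
    refine isCompact_Icc.eventually_forall_of_forall_eventually fun x hx => ?_
    have hmem : (((0, 0), x) : (ℝ × ℝ) × ℝ) ∈ U := by
      refine ⟨⟨mem_univ _, hcd' hx⟩, ?_⟩
      simpa [hD] using hpos x (hcd' hx)
    have hUn : U ∈ 𝓝 (((0, 0), x) : (ℝ × ℝ) × ℝ) := hUo.mem_nhds hmem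
    refine Filter.Eventually.and ?_ ?_
    · filter_upwards [hUn] with z hz using hz.2
    · rw [Filter.eventually_all_finset]
      intro j _
      have hc := (continuousOn_iteratedDeriv_param hUo hHs j).continuousAt hUn
      have hc2 : ContinuousAt (fun z : (ℝ × ℝ) × ℝ => iteratedDeriv j E z.2) ((0, 0), x) :=
        ((hE.continuous_iteratedDeriv j (by exact_mod_cast le_top)).comp continuous_snd).continuousAt
      have hc3 := (hc.sub hc2).abs
      refine hc3.tendsto.eventually (gt_mem_nhds ?_)
      have : iteratedDeriv j (fun y => (D ((0, 0), y))⁻¹) x = iteratedDeriv j E x := by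
        congr 1
        ext y
        simp [hD]
      simpa [this] using hε
  obtain ⟨δ, hδ, hball⟩ := Metric.eventually_nhds_iff_ball.1 hev
  refine ⟨δ / 2, by positivity, fun α hα0 hα A hA => ?_⟩
  set φ := A c - T c with hφ
  set p : ℝ × ℝ := (α * Real.cos (w * φ), α * Real.sin (w * φ)) with hp
  have hpb : p ∈ Metric.ball ((0, 0) : ℝ × ℝ) δ := by
    rw [Metric.mem_ball, Prod.dist_eq]
    simp only [hp, Real.dist_eq, sub_zero, abs_mul, abs_of_nonneg hα0]
    have h1 := Real.abs_cos_le_one (w * φ)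
    have h2 := Real.abs_sin_le_one (w * φ)
    refine max_lt ?_ ?_ <;> nlinarith
  have htw : ∀ x ∈ Ioo a b, twist χ α w A x = T x + φ + (p.1 * P x + p.2 * Q x) := by
    intro x hx
    have := eq_add_of_hasDerivAt_eq hA hT hm hx
    rw [twist, this, ← hφ, mul_add, Real.sin_add]
    simp only [hp, hP, hQ]
    ring
  have hder : ∀ x ∈ Ioo a b, deriv (twist χ α w A) x = D (p, x) := by
    intro x hx
    have hn := isOpen_Ioo.mem_nhds hx
    have e : twist χ α w A =ᶠ[𝓝 x] fun x => T x + φ + (p.1 * P x + p.2 * Q x) := by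
      filter_upwards [hn] with y hy using htw y hy
    rw [e.deriv_eq]
    exact (((hT x hx).add_const φ).add
      (((hPd.differentiableAt hn).hasDerivAt.const_mul p.1).add
        ((hQd.differentiableAt hn).hasDerivAt.const_mul p.2))).deriv
  intro x hx
  obtain ⟨h1, h2⟩ := hball p hpb x hx
  refine ⟨by rwa [hder x (hcd' hx)], fun j hj => ?_⟩
  have e : (fun y => (deriv (twist χ α w A) y)⁻¹) =ᶠ[𝓝 x] fun y => (D (p, y))⁻¹ := by
    filter_upwards [isOpen_Ioo.mem_nhds (hcd' hx)] with y hy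
    rw [hder y hy]
  rw [e.iteratedDeriv_eq]
  exact (h2 j (Finset.mem_range.2 (by omega))).le

/-- The scale of the `k`-th block. -/
noncomputable def scale (k : ℕ) : ℝ := (1 / 2) ^ k

theorem scale_pos (k : ℕ) : 0 < scale k := by unfold scale; positivity

theorem scale_succ (k : ℕ) : scale (k + 1) = scale k / 2 := by
  unfold scale; rw [pow_succ]; ring

theorem scale_le_half {j k : ℕ} (h : j < k) : scale k ≤ scale j / 2 := by
  rw [← scale_succ]
  exact pow_le_pow_of_le_one (by norm_num) (by norm_num) h

theorem scale_le_one (k : ℕ) : scale k ≤ 1 := pow_le_one₀ (by norm_num) (by norm_num)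

theorem tendsto_scale : Tendsto scale atTop (𝓝 0) :=
  tendsto_pow_atTop_nhds_zero_of_lt_one (by norm_num) (by norm_num)

/-- The bump added to the field in the core of the `k`-th block. -/
noncomputable def coreBump (k : ℕ) : ContDiffBump (30 * scale k) :=
  ⟨scale k, 2 * scale k, scale_pos k, by linarith [scale_pos k]⟩

/-- The cutoff localizing the oscillation of the `k`-th block. -/
noncomputable def blockCutoff (k : ℕ) : ContDiffBump (30 * scale k) :=
  ⟨6 * scale k, 8 * scale k, by linarith [scale_pos k], by linarith [scale_pos k]⟩

theorem coreBump_eq_one {k : ℕ} {x : ℝ} (h1 : 29 * scale k ≤ x) (h2 : x ≤ 31 * scale k) :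
    coreBump k x = 1 := by
  refine (coreBump k).one_of_mem_closedBall ?_
  rw [Real.closedBall_eq_Icc]
  constructor <;> simp only [coreBump] <;> linarith

theorem coreBump_eq_zero {k : ℕ} {x : ℝ} (h : x ≤ 28 * scale k ∨ 32 * scale k ≤ x) :
    coreBump k x = 0 := by
  refine (coreBump k).zero_of_le_dist ?_
  rw [Real.dist_eq]
  simp only [coreBump]
  rcases h with h | h
  · exact le_trans (by linarith) (neg_le_abs _)
  · exact le_trans (by linarith) (le_abs_self _)

theorem blockCutoff_eq_one {k : ℕ} {x : ℝ} (h1 : 24 * scale k ≤ x) (h2 : x ≤ 36 * scale k) :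
    blockCutoff k x = 1 := by
  refine (blockCutoff k).one_of_mem_closedBall ?_
  rw [Real.closedBall_eq_Icc]
  constructor <;> simp only [blockCutoff] <;> linarith

theorem blockCutoff_eq_zero {k : ℕ} {x : ℝ} (h : x ≤ 22 * scale k ∨ 38 * scale k ≤ x) :
    blockCutoff k x = 0 := by
  refine (blockCutoff k).zero_of_le_dist ?_
  rw [Real.dist_eq]
  simp only [blockCutoff]
  rcases h with h | h
  · exact le_trans (by linarith) (neg_le_abs _)
  · exact le_trans (by linarith) (le_abs_self _)

/-- The neighbourhood of the `k`-th block which meets no other block. -/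
def blockNhd (k : ℕ) : Set ℝ := Ioo (19 * scale k) (44 * scale k)

theorem isOpen_blockNhd (k : ℕ) : IsOpen (blockNhd k) := isOpen_Ioo

theorem pos_of_mem_blockNhd {k : ℕ} {x : ℝ} (hx : x ∈ blockNhd k) : 0 < x :=
  lt_trans (by linarith [scale_pos k]) hx.1

theorem outside_of_mem_blockNhd {j k : ℕ} (hjk : j ≠ k) {x : ℝ} (hx : x ∈ blockNhd k) :
    x ≤ 22 * scale j ∨ 38 * scale j ≤ x := by
  rcases lt_or_gt_of_ne hjk with h | h
  · exact Or.inl (by linarith [scale_le_half h, hx.2])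
  · exact Or.inr (by linarith [scale_le_half h, hx.1])

theorem exists_mem_blockNhd {x : ℝ} (h0 : 0 < x) (h1 : x ≤ 43) : ∃ k, x ∈ blockNhd k := by
  obtain ⟨n, hn1, hn2⟩ := exists_nat_pow_near_of_lt_one (y := (1 / 2 : ℝ)) (x := x / 43)
    (by positivity) (by linarith) (by norm_num) (by norm_num)
  have h3 : scale n ≤ 2 * scale (n + 1) := by rw [scale_succ]; linarith
  have h4 : scale (n + 1) < x / 43 := hn1
  have h5 : x / 43 ≤ scale n := hn2
  have := scale_pos n
  exact ⟨n, by linarith, by linarith⟩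

/-- A smooth nonnegative bounded function, flat at `0`, which is positive exactly away from the
cores of the blocks. -/
structure Envelope (E : ℝ → ℝ) : Prop where
  smooth : ContDiff ℝ ∞ E
  eq_zero : ∀ x ≤ 0, E x = 0
  nonneg : ∀ x, 0 ≤ E x
  le_one : ∀ x, E x ≤ 1
  core : ∀ k x, 29 * scale k ≤ x → x ≤ 31 * scale k → E x = 0
  pos_left : ∀ k x, 31 / 2 * scale k < x → x < 29 * scale k → 0 < E x
  pos_far : ∀ x, 31 < x → 0 < E x

theorem exists_envelope : ∃ E, Envelope E := by
  set s : Set ℝ := (⋃ k, Ioo (31 / 2 * scale k) (29 * scale k)) ∪ Ioi 31 with hs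
  have hso : IsOpen s := (isOpen_iUnion fun k => isOpen_Ioo).union isOpen_Ioi
  obtain ⟨f, hf, hfs, hfr⟩ := hso.exists_contDiff_support_eq (n := ⊤)
  have hz : ∀ x, x ∉ s → f x = 0 := fun x hx => by
    rw [← hf] at hx; exact Function.notMem_support.1 hx
  have hr : ∀ x, f x ∈ Icc (0 : ℝ) 1 := fun x => hfr (mem_range_self x)
  have hp : ∀ x ∈ s, 0 < f x := fun x hx => by
    rw [← hf] at hx; exact lt_of_le_of_ne (hr x).1 (Ne.symm hx)
  refine ⟨f, hfs, fun x hx => hz x ?_, fun x => (hr x).1, fun x => (hr x).2,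
    fun k x h1 h2 => hz x ?_,
    fun k x h1 h2 => hp x ?_, fun x hx => hp x (Or.inr hx)⟩
  · rintro (h | h)
    · obtain ⟨k, hk⟩ := mem_iUnion.1 h
      linarith [hk.1, scale_pos k]
    · linarith [show (31 : ℝ) < x from h]
  · rintro (h | h)
    · obtain ⟨j, hj⟩ := mem_iUnion.1 h
      rcases lt_trichotomy j k with h | rfl | h
      · linarith [scale_le_half h, hj.1]
      · linarith [hj.2]
      · linarith [scale_le_half h, hj.2, scale_pos k]
    · linarith [show (31 : ℝ) < x from h, scale_le_one k]
  · exact Or.inl (mem_iUnion.2 ⟨k, h1, h2⟩)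

namespace Envelope

variable {E : ℝ → ℝ} (hE : Envelope E)
include hE

theorem pos_right (k : ℕ) (x : ℝ) (h1 : 31 * scale k < x) (h2 : x < 58 * scale k) : 0 < E x := by
  rcases k with _ | k
  · exact hE.pos_far x (by simpa [scale] using h1)
  · exact hE.pos_left k x (by linarith [scale_succ k]) (by linarith [scale_succ k])

theorem add_pos {k : ℕ} {l x : ℝ} (hl : 0 < l) (hx : x ∈ blockNhd k) :
    0 < E x + l * coreBump k x := by
  have h1 := hE.nonneg x
  have h2 : 0 ≤ l * coreBump k x := mul_nonneg hl.le (coreBump k).nonneg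
  rcases lt_or_ge x (29 * scale k) with h | h
  · linarith [hE.pos_left k x (by linarith [scale_pos k, hx.1]) h]
  rcases lt_or_ge (31 * scale k) x with h' | h'
  · linarith [hE.pos_right k x h' (by linarith [scale_pos k, hx.2])]
  · rw [coreBump_eq_one h h']; linarith

end Envelope

/-- The parameters of the `k`-th block: the amplitude `α` of the oscillation of frequency `q`, the
height `l` of the field in the core, and a bound `M` on the resulting field. -/
structure BlockData (E : ℝ → ℝ) (k q : ℕ) (α l M : ℝ) : Prop where
  α_pos : 0 < α
  α_le_one : α ≤ 1
  α_le : 2 * Real.pi * q * α ≤ 1 / 2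
  α_sq_le : (2 * Real.pi * q) ^ 2 * α ≤ scale k
  collar : ∀ A : ℝ → ℝ, (∀ x ∈ Ioo (16 * scale k) (28 * scale k) ∪
      Ioo (32 * scale k) (56 * scale k), HasDerivAt A (E x)⁻¹ x) →
    ∀ x ∈ Icc (19 * scale k) (27 * scale k) ∪ Icc (33 * scale k) (44 * scale k),
      0 < deriv (twist (blockCutoff k) α (2 * Real.pi * q) A) x ∧ ∀ j ≤ k,
        |iteratedDeriv j (fun y => (deriv (twist (blockCutoff k) α (2 * Real.pi * q) A) y)⁻¹) x
          - iteratedDeriv j E x| ≤ scale k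
  l_pos : 0 < l
  bump_le : ∀ j ≤ k, ∀ x, l * |iteratedDeriv j (coreBump k) x| ≤ scale k
  l_le : l * (k + 1) ≤ 2 * Real.pi * q * α
  l_le_scale : l ≤ scale k / 2
  M_pos : 0 < M
  field_le : ∀ A : ℝ → ℝ, A (30 * scale k) = 0 →
    (∀ x ∈ blockNhd k, HasDerivAt A (E x + l * coreBump k x)⁻¹ x) →
    ∀ x ∈ Icc (25 * scale k) (35 * scale k), ∀ j ≤ k,
      |iteratedDeriv j (fun y => (deriv (twist (blockCutoff k) α (2 * Real.pi * q) A) y)⁻¹) x| ≤ M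

theorem exists_bound_iteratedDeriv {G : ℝ → ℝ} {U C : Set ℝ} (hU : IsOpen U)
    (hG : ContDiffOn ℝ ∞ G U) (hC : IsCompact C) (hCU : C ⊆ U) (n : ℕ) :
    ∃ B > 0, ∀ j ≤ n, ∀ x ∈ C, |iteratedDeriv j G x| ≤ B := by
  have h : ∀ j : ℕ, ∃ B, ∀ x ∈ C, |iteratedDeriv j G x| ≤ B := fun j => by
    refine hC.exists_bound_of_continuousOn (f := iteratedDeriv j G) ?_
    have := hG.continuousOn_iteratedDerivWithin (m := j) (by exact_mod_cast le_top)
      hU.uniqueDiffOn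
    exact (this.congr fun x hx => (iteratedDerivWithin_of_isOpen hU hx).symm).mono hCU
  choose B hB using h
  refine ⟨1 + ∑ j ∈ Finset.range (n + 1), |B j|, by positivity, fun j hj x hx => ?_⟩
  have := Finset.single_le_sum (f := fun j => |B j|) (fun j _ => abs_nonneg _)
    (Finset.mem_range.2 (Nat.lt_succ_of_le hj))
  linarith [hB j x hx, le_abs_self (B j)]

theorem exists_bound_iteratedDeriv_coreBump (k : ℕ) :
    ∃ B > 0, ∀ j ≤ k, ∀ x, |iteratedDeriv j (coreBump k) x| ≤ B := by
  obtain ⟨B, hB, h⟩ := exists_bound_iteratedDeriv isOpen_univ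
    (coreBump k).contDiff.contDiffOn (isCompact_Icc (a := 28 * scale k) (b := 32 * scale k))
    (subset_univ _) k
  refine ⟨B, hB, fun j hj x => ?_⟩
  by_cases hx : x ∈ Icc (28 * scale k) (32 * scale k)
  · exact h j hj x hx
  have : (coreBump k : ℝ → ℝ) =ᶠ[𝓝 x] fun _ => 0 := by
    filter_upwards [isClosed_Icc.isOpen_compl.mem_nhds hx] with y hy
    refine coreBump_eq_zero ?_
    by_contra! hcon
    exact hy ⟨hcon.1.le, hcon.2.le⟩
  rw [this.iteratedDeriv_eq]
  simpa using hB.le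

theorem twist_deriv_of_one {χ A : ℝ → ℝ} {α w a' x : ℝ} (hχ : χ =ᶠ[𝓝 x] fun _ => 1)
    (hA : HasDerivAt A a' x) :
    deriv (twist χ α w A) x = a' * (1 + w * α * Real.cos (w * A x)) := by
  have e : twist χ α w A =ᶠ[𝓝 x] fun y => A y + α * Real.sin (w * A y) := by
    filter_upwards [hχ] with y hy
    simp [twist, hy]
  have h : HasDerivAt (fun y => A y + α * Real.sin (w * A y)) _ x :=
    hA.add ((hA.const_mul w).sin.const_mul α)
  rw [e.deriv_eq, h.deriv]
  ring

theorem one_add_mul_cos_pos {b : ℝ} (hb : 0 ≤ b) (hb' : b ≤ 1 / 2) (y : ℝ) :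
    1 / 2 ≤ 1 + b * Real.cos y := by
  nlinarith [Real.neg_one_le_cos y]


theorem contDiffOn_twist {χ A : ℝ → ℝ} {s : Set ℝ} (hχ : ContDiff ℝ ∞ χ) (hA : ContDiffOn ℝ ∞ A s)
    (α w : ℝ) : ContDiffOn ℝ ∞ (twist χ α w A) s :=
  hA.add (contDiffOn_const.mul (hχ.contDiffOn.mul
    (Real.contDiff_sin.comp_contDiffOn (contDiffOn_const.mul hA))))

theorem blockCutoff_eventuallyEq_one {k : ℕ} {x : ℝ}
    (hx : x ∈ Ioo (24 * scale k) (36 * scale k)) : (blockCutoff k : ℝ → ℝ) =ᶠ[𝓝 x] fun _ => 1 := by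
  filter_upwards [isOpen_Ioo.mem_nhds hx] with y hy using blockCutoff_eq_one hy.1.le hy.2.le

theorem Envelope.exists_blockData {E : ℝ → ℝ} (hE : Envelope E) (k : ℕ) {q : ℕ} (hq : 0 < q) :
    ∃ α l M, BlockData E k q α l M := by
  have hu := scale_pos k
  set w : ℝ := 2 * Real.pi * q with hw
  have hw0 : 0 < w := by
    have : (0 : ℝ) < q := by exact_mod_cast hq
    positivity
  have hcut : ContDiff ℝ ∞ (blockCutoff k) := (blockCutoff k).contDiff
  obtain ⟨α₁, hα₁, hleft⟩ := exists_twist_bound (χ := blockCutoff k) (a := 16 * scale k)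
    (b := 28 * scale k) (c := 19 * scale k) (d := 27 * scale k) hE.smooth
    (fun x hx => hE.pos_left k x (by linarith [hx.1]) (by linarith [hx.2])) hcut
    (by linarith) (by linarith)
    (by linarith) w k hu
  obtain ⟨α₂, hα₂, hright⟩ := exists_twist_bound (χ := blockCutoff k) (a := 32 * scale k)
    (b := 56 * scale k) (c := 33 * scale k) (d := 44 * scale k) hE.smooth
    (fun x hx => hE.pos_right k x (by linarith [hx.1]) (by linarith [hx.2])) hcut
    (by linarith) (by linarith)
    (by linarith) w k hu
  obtain ⟨α, hα0, hα⟩ : ∃ α > 0, α ≤ α₁ ∧ α ≤ α₂ ∧ α ≤ 1 ∧ α ≤ 1 / (2 * w) ∧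
      α ≤ scale k / w ^ 2 := by
    refine ⟨min α₁ (min α₂ (min 1 (min (1 / (2 * w)) (scale k / w ^ 2)))), ?_, ?_⟩
    · refine lt_min hα₁ (lt_min hα₂ (lt_min one_pos (lt_min ?_ ?_))) <;> positivity
    · simp
  obtain ⟨h1, h2, h3, h4, h5⟩ := hα
  obtain ⟨B, hB0, hB⟩ := exists_bound_iteratedDeriv_coreBump k
  obtain ⟨l, hl0, hl⟩ : ∃ l > 0, l ≤ scale k / 2 ∧ l ≤ w * α / (k + 1) ∧ l ≤ scale k / B := by
    refine ⟨min (scale k / 2) (min (w * α / (k + 1)) (scale k / B)), ?_, ?_⟩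
    · refine lt_min (half_pos hu) (lt_min ?_ ?_) <;> positivity
    · simp
  obtain ⟨h6, h7, h8⟩ := hl
  have hwα : w * α ≤ 1 / 2 := by
    rw [le_div_iff₀ (by positivity)] at h4
    linarith
  have hm : 30 * scale k ∈ Ioo (19 * scale k) (44 * scale k) := ⟨by linarith, by linarith⟩
  have hfs : ContDiff ℝ ∞ fun x => E x + l * coreBump k x :=
    hE.smooth.add (contDiff_const.mul (coreBump k).contDiff)
  have hpos : ∀ x ∈ blockNhd k, 0 < E x + l * coreBump k x := fun x hx => hE.add_pos hl0 hx
  obtain ⟨A₀, hA₀, hA₀'⟩ := exists_hasDerivAt_inv hfs.continuous.continuousOn hpos hm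
  have hA₀s : ContDiffOn ℝ ∞ A₀ (blockNhd k) :=
    contDiffOn_of_hasDerivAt isOpen_Ioo hA₀' (hfs.contDiffOn.inv fun x hx => (hpos x hx).ne')
  have hsub : Ioo (24 * scale k) (36 * scale k) ⊆ blockNhd k := fun x hx =>
    ⟨by linarith [hx.1], by linarith [hx.2]⟩
  have hsub' : Icc (25 * scale k) (35 * scale k) ⊆ Ioo (24 * scale k) (36 * scale k) := fun x hx =>
    ⟨by linarith [hx.1], by linarith [hx.2]⟩
  obtain ⟨M, hM0, hM⟩ := exists_bound_iteratedDeriv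
    (G := fun y => (deriv (twist (blockCutoff k) α w A₀) y)⁻¹)
    (isOpen_Ioo (a := 24 * scale k) (b := 36 * scale k)) (by
      have h := contDiffOn_twist hcut hA₀s α w
      have h' := ((contDiffOn_infty_iff_deriv_of_isOpen isOpen_Ioo).1 h).2.mono hsub
      refine h'.inv fun x hx => ?_
      rw [twist_deriv_of_one (blockCutoff_eventuallyEq_one hx) (hA₀' x (hsub hx))]
      have := one_add_mul_cos_pos (by positivity) hwα (w * A₀ x)
      exact mul_ne_zero (inv_pos.2 (hpos x (hsub hx))).ne' (by linarith))
    isCompact_Icc hsub' k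
  refine ⟨α, l, M, hα0, h3, hwα, ?_, ?_, hl0, ?_, ?_, h6, hM0, ?_⟩
  · rwa [le_div_iff₀' (by positivity)] at h5
  · rintro A hA x (hx | hx)
    · exact hleft α hα0.le h1 A (fun y hy => hA y (Or.inl hy)) x hx
    · exact hright α hα0.le h2 A (fun y hy => hA y (Or.inr hy)) x hx
  · intro j hj x
    rw [le_div_iff₀ hB0] at h8
    nlinarith [hB j hj x]
  · rwa [le_div_iff₀ (by positivity)] at h7
  · intro A hA hA' x hx j hj
    have heq : ∀ y ∈ blockNhd k, A y = A₀ y := fun y hy => by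
      have := eq_add_of_hasDerivAt_eq hA' hA₀' hm hy
      rwa [hA, hA₀, sub_zero, add_zero] at this
    have e : (fun y => (deriv (twist (blockCutoff k) α w A) y)⁻¹) =ᶠ[𝓝 x]
        fun y => (deriv (twist (blockCutoff k) α w A₀) y)⁻¹ := by
      filter_upwards [isOpen_Ioo.mem_nhds (hsub (hsub' hx))] with y hy
      have : twist (blockCutoff k) α w A =ᶠ[𝓝 y] twist (blockCutoff k) α w A₀ := by
        filter_upwards [isOpen_Ioo.mem_nhds hy] with z hz
        simp only [twist, heq z hz]
      rw [this.deriv_eq]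
    rw [e.iteratedDeriv_eq]
    exact hM j hj x hx

/-- The field without oscillations. -/
noncomputable def baseField (E : ℝ → ℝ) (l : ℕ → ℝ) (x : ℝ) : ℝ :=
  E x + ∑' k, l k * coreBump k x

/-- The time coordinate of the field without oscillations. -/
noncomputable def baseChart (E : ℝ → ℝ) (l : ℕ → ℝ) (x : ℝ) : ℝ :=
  ∫ y in (30 : ℝ)..x, (baseField E l y)⁻¹

/-- The time coordinate with an oscillation added in each block. -/
noncomputable def blockChart (E : ℝ → ℝ) (q : ℕ → ℕ) (α l : ℕ → ℝ) (x : ℝ) : ℝ :=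
  baseChart E l x + ∑' k, α k * (blockCutoff k x *
    Real.sin (2 * Real.pi * q k * (baseChart E l x - baseChart E l (30 * scale k))))

/-- The vector field with time coordinate `blockChart`. -/
noncomputable def blockField (E : ℝ → ℝ) (q : ℕ → ℕ) (α l : ℕ → ℝ) (x : ℝ) : ℝ :=
  if 0 < x then (deriv (blockChart E q α l) x)⁻¹ else 0

/-- An envelope together with parameters for all blocks. -/
structure Blocks (E : ℝ → ℝ) (q : ℕ → ℕ) (α l M : ℕ → ℝ) : Prop where
  env : Envelope E
  block : ∀ k, BlockData E k (q k) (α k) (l k) (M k)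

namespace Blocks

variable {E : ℝ → ℝ} {q : ℕ → ℕ} {α l M : ℕ → ℝ} 

theorem baseField_eq (E : ℝ → ℝ) (l : ℕ → ℝ) {k : ℕ} {x : ℝ} (hx : x ∈ blockNhd k) :
    baseField E l x = E x + l k * coreBump k x := by
  rw [baseField, tsum_eq_single k]
  intro j hj
  rw [coreBump_eq_zero, mul_zero]
  have := scale_pos j
  exact (outside_of_mem_blockNhd hj hx).imp (fun h => by linarith) fun h => by linarith

theorem baseField_eq_of_forall (E : ℝ → ℝ) (l : ℕ → ℝ) {x : ℝ}
    (hx : ∀ k, x ≤ 28 * scale k ∨ 32 * scale k ≤ x) : baseField E l x = E x := by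
  rw [baseField]
  simp [coreBump_eq_zero (hx _)]

theorem baseField_far (E : ℝ → ℝ) (l : ℕ → ℝ) {x : ℝ} (hx : 32 ≤ x) : baseField E l x = E x :=
  baseField_eq_of_forall E l fun k => Or.inr (by linarith [scale_le_one k])

theorem baseField_collar (E : ℝ → ℝ) (l : ℕ → ℝ) {k : ℕ} {x : ℝ}
    (hx : x ∈ Ioo (16 * scale k) (28 * scale k) ∪ Ioo (32 * scale k) (56 * scale k)) :
    baseField E l x = E x := by
  refine baseField_eq_of_forall E l fun j => ?_
  have := scale_pos k
  rcases lt_trichotomy j k with h | rfl | h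
  · have := scale_le_half h
    rcases hx with hx | hx <;> exact Or.inl (by linarith [hx.2])
  · exact hx.imp (fun h => h.2.le) fun h => h.1.le
  · have := scale_le_half h
    rcases hx with hx | hx <;> exact Or.inr (by linarith [hx.1])

theorem mem_blockNhd_or {x : ℝ} (hx : 0 < x) : (∃ k, x ∈ blockNhd k) ∨ 38 < x := by
  rcases le_or_gt x 43 with h | h
  · exact Or.inl (exists_mem_blockNhd hx h)
  · exact Or.inr (by linarith)

theorem baseField_eventuallyEq (E : ℝ → ℝ) (l : ℕ → ℝ) {k : ℕ} {x : ℝ} (hx : x ∈ blockNhd k) :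
    baseField E l =ᶠ[𝓝 x] fun y => E y + l k * coreBump k y := by
  filter_upwards [(isOpen_blockNhd k).mem_nhds hx] with y hy using baseField_eq E l hy

theorem contDiffOn_baseField (h : Blocks E q α l M) : ContDiffOn ℝ ∞ (baseField E l) (Ioi 0) := by
  intro x hx
  refine ContDiffAt.contDiffWithinAt ?_
  rcases mem_blockNhd_or hx with ⟨k, hk⟩ | hk
  · exact
      (h.env.smooth.add (contDiff_const.mul (coreBump k).contDiff)).contDiffAt.congr_of_eventuallyEq
      (baseField_eventuallyEq E l hk)
  · refine (h.env.smooth.contDiffAt).congr_of_eventuallyEq ?_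
    filter_upwards [Ioi_mem_nhds hk] with y hy
    exact baseField_far E l (by linarith [show (38 : ℝ) < y from hy])

theorem baseField_pos (h : Blocks E q α l M) {x : ℝ} (hx : 0 < x) : 0 < baseField E l x := by
  rcases mem_blockNhd_or hx with ⟨k, hk⟩ | hk
  · rw [baseField_eq E l hk]
    exact h.env.add_pos (h.block k).l_pos hk
  · rw [baseField_far E l (by linarith)]
    exact h.env.pos_far x (by linarith)

theorem hasDerivAt_baseChart (h : Blocks E q α l M) {x : ℝ} (hx : 0 < x) :
    HasDerivAt (baseChart E l) (baseField E l x)⁻¹ x := by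
  have hc : ContinuousOn (fun x => (baseField E l x)⁻¹) (Ioi 0) :=
    h.contDiffOn_baseField.continuousOn.inv₀ fun x hx => (h.baseField_pos hx).ne'
  have hsub : uIcc 30 x ⊆ Ioi 0 := ordConnected_Ioi.uIcc_subset (by simp) hx
  exact intervalIntegral.integral_hasDerivAt_right
    ((hc.mono hsub).intervalIntegrable)
    (hc.stronglyMeasurableAtFilter isOpen_Ioi x hx) (hc.continuousAt (isOpen_Ioi.mem_nhds hx))

theorem contDiffOn_baseChart (h : Blocks E q α l M) : ContDiffOn ℝ ∞ (baseChart E l) (Ioi 0) :=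
  contDiffOn_of_hasDerivAt isOpen_Ioi (fun _ hx => h.hasDerivAt_baseChart hx)
    (h.contDiffOn_baseField.inv fun _ hx => (h.baseField_pos hx).ne')

/-- The base chart normalized at the centre of the `k`-th block. -/
noncomputable def localChart (E : ℝ → ℝ) (l : ℕ → ℝ) (k : ℕ) (x : ℝ) : ℝ :=
  baseChart E l x - baseChart E l (30 * scale k)

theorem blockChart_eq (E : ℝ → ℝ) (q : ℕ → ℕ) (α l : ℕ → ℝ) {k : ℕ} {x : ℝ}
    (hx : x ∈ blockNhd k) :
    blockChart E q α l x =
      twist (blockCutoff k) (α k) (2 * Real.pi * q k) (localChart E l k) x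
        + baseChart E l (30 * scale k) := by
  rw [blockChart, twist, tsum_eq_single k]
  · simp only [localChart]; ring
  · intro j hj
    rw [blockCutoff_eq_zero (outside_of_mem_blockNhd hj hx)]
    simp

theorem blockChart_far (E : ℝ → ℝ) (q : ℕ → ℕ) (α l : ℕ → ℝ) {x : ℝ} (hx : 38 ≤ x) :
    blockChart E q α l x = baseChart E l x := by
  rw [blockChart]
  have : ∀ k, blockCutoff k x = 0 := fun k => blockCutoff_eq_zero (Or.inr
    (by linarith [scale_le_one k]))
  simp [this]

theorem blockChart_eventuallyEq (E : ℝ → ℝ) (q : ℕ → ℕ) (α l : ℕ → ℝ) {k : ℕ} {x : ℝ}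
    (hx : x ∈ blockNhd k) : blockChart E q α l =ᶠ[𝓝 x] fun y =>
      twist (blockCutoff k) (α k) (2 * Real.pi * q k) (localChart E l k) y
        + baseChart E l (30 * scale k) := by
  filter_upwards [(isOpen_blockNhd k).mem_nhds hx] with y hy using blockChart_eq E q α l hy

theorem blockChart_far_eventuallyEq (E : ℝ → ℝ) (q : ℕ → ℕ) (α l : ℕ → ℝ) {x : ℝ}
    (hx : 38 < x) : blockChart E q α l =ᶠ[𝓝 x] baseChart E l := by
  filter_upwards [Ioi_mem_nhds hx] with y hy
    using blockChart_far E q α l (show (38 : ℝ) < y from hy).le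

theorem deriv_blockChart_eq (E : ℝ → ℝ) (q : ℕ → ℕ) (α l : ℕ → ℝ) {k : ℕ} {x : ℝ}
    (hx : x ∈ blockNhd k) : deriv (blockChart E q α l) x =
      deriv (twist (blockCutoff k) (α k) (2 * Real.pi * q k) (localChart E l k)) x := by
  rw [(blockChart_eventuallyEq E q α l hx).deriv_eq, deriv_add_const]

theorem hasDerivAt_localChart (h : Blocks E q α l M) (k : ℕ) {x : ℝ} (hx : 0 < x) :
    HasDerivAt (localChart E l k) (baseField E l x)⁻¹ x :=
  (h.hasDerivAt_baseChart hx).sub_const _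

theorem hasDerivAt_localChart_collar (h : Blocks E q α l M) (k : ℕ) {x : ℝ}
    (hx : x ∈ Ioo (16 * scale k) (28 * scale k) ∪ Ioo (32 * scale k) (56 * scale k)) :
    HasDerivAt (localChart E l k) (E x)⁻¹ x := by
  have h0 : 0 < x := by
    have := scale_pos k
    rcases hx with hx | hx <;> linarith [hx.1]
  rw [← baseField_collar E l hx]
  exact h.hasDerivAt_localChart k h0

theorem deriv_blockChart_core (h : Blocks E q α l M) {k : ℕ} {x : ℝ}
    (hx : x ∈ Ioo (24 * scale k) (36 * scale k)) : deriv (blockChart E q α l) x =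
      (baseField E l x)⁻¹ * (1 + 2 * Real.pi * q k * α k *
        Real.cos (2 * Real.pi * q k * localChart E l k x)) := by
  have hu := scale_pos k
  rw [deriv_blockChart_eq E q α l (k := k) ⟨by linarith [hx.1], by linarith [hx.2]⟩]
  exact twist_deriv_of_one (blockCutoff_eventuallyEq_one hx)
    (h.hasDerivAt_localChart k (by linarith [hx.1]))

theorem contDiffOn_blockChart (h : Blocks E q α l M) :
    ContDiffOn ℝ ∞ (blockChart E q α l) (Ioi 0) := by
  intro x hx
  have hb := h.contDiffOn_baseChart.contDiffAt (Ioi_mem_nhds hx)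
  refine ContDiffAt.contDiffWithinAt ?_
  rcases mem_blockNhd_or hx with ⟨k, hk⟩ | hk
  · refine ContDiffAt.congr_of_eventuallyEq ?_ (blockChart_eventuallyEq E q α l hk)
    have hl : ContDiffOn ℝ ∞ (localChart E l k) (Ioi 0) :=
      h.contDiffOn_baseChart.sub contDiffOn_const
    exact ((contDiffOn_twist (blockCutoff k).contDiff hl _ _).contDiffAt
      (Ioi_mem_nhds hx)).add contDiffAt_const
  · exact hb.congr_of_eventuallyEq (blockChart_far_eventuallyEq E q α l hk)

theorem collar_or_core {k : ℕ} {x : ℝ} (hx : x ∈ blockNhd k) :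
    x ∈ Icc (19 * scale k) (27 * scale k) ∪ Icc (33 * scale k) (44 * scale k) ∨
      x ∈ Ioo (27 * scale k) (33 * scale k) := by
  rcases le_or_gt x (27 * scale k) with h | h
  · exact Or.inl (Or.inl ⟨hx.1.le, h⟩)
  rcases le_or_gt (33 * scale k) x with h' | h'
  · exact Or.inl (Or.inr ⟨h', hx.2.le⟩)
  · exact Or.inr ⟨h, h'⟩

theorem core_subset {k : ℕ} {x : ℝ} (hx : x ∈ Ioo (27 * scale k) (33 * scale k)) :
    x ∈ Ioo (24 * scale k) (36 * scale k) := by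
  have := scale_pos k
  exact ⟨by linarith [hx.1], by linarith [hx.2]⟩

theorem one_add_core_pos (h : Blocks E q α l M) (k : ℕ) (y : ℝ) :
    1 / 2 ≤ 1 + 2 * Real.pi * q k * α k * Real.cos y :=
  one_add_mul_cos_pos (by have := (h.block k).α_pos; positivity) (h.block k).α_le _

theorem deriv_blockChart_pos (h : Blocks E q α l M) {x : ℝ} (hx : 0 < x) :
    0 < deriv (blockChart E q α l) x := by
  rcases mem_blockNhd_or hx with ⟨k, hk⟩ | hk
  · rcases collar_or_core hk with hc | hc
    · rw [deriv_blockChart_eq E q α l hk]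
      exact ((h.block k).collar _ (fun y hy => h.hasDerivAt_localChart_collar k hy) x hc).1
    · rw [h.deriv_blockChart_core (core_subset hc)]
      have := h.one_add_core_pos k (2 * Real.pi * q k * localChart E l k x)
      exact mul_pos (inv_pos.2 (h.baseField_pos hx)) (by linarith)
  · rw [(blockChart_far_eventuallyEq E q α l hk).deriv_eq, (h.hasDerivAt_baseChart hx).deriv]
    exact inv_pos.2 (h.baseField_pos hx)

theorem baseField_le (h : Blocks E q α l M) : ∃ C > 0, ∀ x, 0 < x → baseField E l x ≤ C * x := by
  obtain ⟨B, hB, hE1⟩ := exists_bound_iteratedDeriv isOpen_univ h.env.smooth.contDiffOn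
    (isCompact_Icc (a := (0 : ℝ)) (b := 1)) (subset_univ _) 1
  have hE : ∀ x, 0 < x → E x ≤ (B + 1) * x := by
    intro x hx
    rcases le_total x 1 with hx1 | hx1
    · have := (convex_Icc (0 : ℝ) 1).norm_image_sub_le_of_norm_deriv_le (f := E) (C := B)
        (fun y _ => (h.env.smooth.differentiable (by simp)).differentiableAt)
        (fun y hy => by simpa [iteratedDeriv_one] using hE1 1 le_rfl y hy)
        (left_mem_Icc.2 zero_le_one) ⟨hx.le, hx1⟩
      rw [h.env.eq_zero 0 le_rfl, sub_zero, sub_zero, Real.norm_eq_abs, Real.norm_eq_abs,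
        abs_of_pos hx] at this
      linarith [le_abs_self (E x)]
    · nlinarith [h.env.le_one x]
  refine ⟨B + 2, by positivity, fun x hx => ?_⟩
  rcases mem_blockNhd_or hx with ⟨k, hk⟩ | hk
  · rw [baseField_eq E l hk]
    have h1 : l k * coreBump k x ≤ l k * 1 :=
      mul_le_mul_of_nonneg_left (coreBump k).le_one (h.block k).l_pos.le
    have := (h.block k).l_le_scale
    linarith [hE x hx, hk.1, scale_pos k]
  · rw [baseField_far E l (by linarith)]
    linarith [hE x hx]

theorem baseChart_surj (h : Blocks E q α l M) (s : ℝ) : ∃ x, 0 < x ∧ baseChart E l x = s := by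
  obtain ⟨C, hC, hle⟩ := h.baseField_le
  set g : ℝ → ℝ := fun x => baseChart E l x - C⁻¹ * Real.log x with hg
  have hgd : ∀ x, 0 < x → HasDerivAt g ((baseField E l x)⁻¹ - C⁻¹ * x⁻¹) x := fun x hx =>
    (h.hasDerivAt_baseChart hx).sub ((Real.hasDerivAt_log hx.ne').const_mul _)
  have hmono : MonotoneOn g (Ioi 0) := by
    refine monotoneOn_of_deriv_nonneg (convex_Ioi 0)
      (fun x hx => (hgd x hx).continuousAt.continuousWithinAt)
      (fun x hx => (hgd x (interior_subset hx)).differentiableAt.differentiableWithinAt)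
      fun x hx => ?_
    have hx0 : 0 < x := interior_subset hx
    rw [(hgd x hx0).deriv, sub_nonneg, ← mul_inv]
    exact inv_anti₀ (h.baseField_pos hx0) (hle x hx0)
  set b := C * (|s| + |g 1|) with hb
  have hb0 : 0 ≤ b := by positivity
  have hCb : C⁻¹ * b = |s| + |g 1| := by rw [hb]; field_simp
  have e1 := hmono (mem_Ioi.2 (Real.exp_pos (-b))) (mem_Ioi.2 one_pos)
    (Real.exp_le_one_iff.2 (by linarith))
  have e2 := hmono (mem_Ioi.2 one_pos) (mem_Ioi.2 (Real.exp_pos b)) (Real.one_le_exp hb0)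
  have hc : ContinuousOn (baseChart E l) (Ioi 0) := h.contDiffOn_baseChart.continuousOn
  have := isPreconnected_Ioi.intermediate_value (mem_Ioi.2 (Real.exp_pos (-b)))
    (mem_Ioi.2 (Real.exp_pos b)) hc
  obtain ⟨x, hx, hxs⟩ := this (show s ∈ Icc _ _ by
    simp only [hg, Real.log_exp] at e1 e2
    have := neg_abs_le s
    have := le_abs_self s
    have := le_abs_self (g 1)
    have := neg_abs_le (g 1)
    simp only [hg] at *
    constructor <;> linarith)
  exact ⟨x, hx, hxs⟩

theorem timeChart_base (h : Blocks E q α l M) : TimeChart (baseField E l) (baseChart E l) :=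
  ⟨h.contDiffOn_baseChart, fun _ hx => h.baseField_pos hx, fun _ hx => h.hasDerivAt_baseChart hx,
    h.baseChart_surj⟩

theorem abs_blockChart_sub_le (h : Blocks E q α l M) {x : ℝ} (hx : 0 < x) :
    |blockChart E q α l x - baseChart E l x| ≤ 1 := by
  rcases mem_blockNhd_or hx with ⟨k, hk⟩ | hk
  · rw [blockChart_eq E q α l hk, twist, localChart]
    set c := Real.sin (2 * Real.pi * q k * (baseChart E l x - baseChart E l (30 * scale k)))
    have h1 : |c| ≤ 1 := Real.abs_sin_le_one _
    have h2 : |(blockCutoff k x : ℝ)| ≤ 1 :=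
      abs_le.2 ⟨by linarith [(blockCutoff k).nonneg' x], (blockCutoff k).le_one⟩
    have h3 : |α k| ≤ 1 := by
      rw [abs_of_pos (h.block k).α_pos]; exact (h.block k).α_le_one
    rw [show ∀ a b y : ℝ, a - b + y + b - a = y by intros; ring, abs_mul, abs_mul]
    exact mul_le_one₀ h3 (by positivity) (mul_le_one₀ h2 (abs_nonneg _) h1)
  · rw [blockChart_far E q α l hk.le]; simp

theorem blockChart_surj (h : Blocks E q α l M) (s : ℝ) :
    ∃ x, 0 < x ∧ blockChart E q α l x = s := by
  obtain ⟨a, ha, hsa⟩ := h.baseChart_surj (s - 1)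
  obtain ⟨b, hb, hsb⟩ := h.baseChart_surj (s + 1)
  have h1 := abs_le.1 (h.abs_blockChart_sub_le ha)
  have h2 := abs_le.1 (h.abs_blockChart_sub_le hb)
  obtain ⟨x, hx, hxs⟩ := isPreconnected_Ioi.intermediate_value (mem_Ioi.2 ha) (mem_Ioi.2 hb)
    h.contDiffOn_blockChart.continuousOn (show s ∈ Icc _ _ by constructor <;> linarith)
  exact ⟨x, hx, hxs⟩

theorem blockField_of_pos (E : ℝ → ℝ) (q : ℕ → ℕ) (α l : ℕ → ℝ) {x : ℝ} (hx : 0 < x) :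
    blockField E q α l x = (deriv (blockChart E q α l) x)⁻¹ := if_pos hx

theorem blockField_of_nonpos (E : ℝ → ℝ) (q : ℕ → ℕ) (α l : ℕ → ℝ) {x : ℝ} (hx : x ≤ 0) :
    blockField E q α l x = 0 := if_neg hx.not_gt

theorem timeChart (h : Blocks E q α l M) : TimeChart (blockField E q α l) (blockChart E q α l) := by
  refine ⟨h.contDiffOn_blockChart, fun x hx => ?_, fun x hx => ?_, h.blockChart_surj⟩
  · rw [blockField_of_pos E q α l hx]
    exact inv_pos.2 (h.deriv_blockChart_pos hx)
  · rw [blockField_of_pos E q α l hx, inv_inv]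
    exact ((h.contDiffOn_blockChart.contDiffAt (Ioi_mem_nhds hx)).differentiableAt
      (by simp)).hasDerivAt

end Blocks

theorem exists_le_mul_of_contDiff_one {g : ℝ → ℝ} (hg : ContDiff ℝ 1 g) (h0 : ∀ x ≤ 0, g x = 0)
    {κ : ℝ} (hκ : 0 < κ) : ∃ ρ > 0, ∀ x, 0 < x → x < ρ → g x ≤ κ * x := by
  have hd : HasDerivAt g (deriv g 0) 0 := (hg.differentiable (by simp) 0).hasDerivAt
  have hd0 : deriv g 0 = 0 := by
    have h1 : HasDerivWithinAt g 0 (Iic 0) 0 :=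
      (hasDerivWithinAt_const (0 : ℝ) (Iic 0) (0 : ℝ)).congr (fun x hx => h0 x hx) (h0 0 le_rfl)
    exact (uniqueDiffOn_Iic (0 : ℝ) 0 self_mem_Iic).eq_deriv _ hd.hasDerivWithinAt h1
  rw [hd0] at hd
  have := hd.isLittleO.def hκ
  simp only [h0 0 le_rfl, sub_zero, smul_zero] at this
  obtain ⟨ρ, hρ, hb⟩ := Metric.eventually_nhds_iff.1 this
  refine ⟨ρ, hρ, fun x hx hxρ => ?_⟩
  have := hb (y := x) (by rwa [Real.dist_eq, sub_zero, abs_of_pos hx])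
  rw [Real.norm_eq_abs, Real.norm_eq_abs, abs_of_pos hx] at this
  exact (le_abs_self _).trans this

theorem Envelope.exists_iteratedDeriv_le {E : ℝ → ℝ} (hE : Envelope E) (n : ℕ) {ε : ℝ}
    (hε : 0 < ε) : ∃ ρ > 0, ∀ x, 0 < x → x < ρ → ∀ j ≤ n, |iteratedDeriv j E x| ≤ ε := by
  have : ∀ᶠ x in 𝓝 (0 : ℝ), ∀ j ∈ Finset.range (n + 1), |iteratedDeriv j E x| < ε := by
    rw [Filter.eventually_all_finset]
    intro j _
    have := (tendsto_iteratedDeriv_of_eq_zero hE.smooth hE.eq_zero j).abs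
    rw [abs_zero] at this
    exact this.eventually (gt_mem_nhds hε)
  obtain ⟨ρ, hρ, hb⟩ := Metric.eventually_nhds_iff.1 this
  refine ⟨ρ, hρ, fun x hx hxρ j hj => (hb (y := x) ?_ j (Finset.mem_range.2 (by omega))).le⟩
  rwa [Real.dist_eq, sub_zero, abs_of_pos hx]

theorem exists_scale_le_of_lt (n : ℕ) {ε : ℝ} (hε : 0 < ε) :
    ∃ ρ > 0, ρ < 19 ∧ ∀ k x, x ∈ blockNhd k → x < ρ → n ≤ k ∧ scale k ≤ ε := by
  have hn := scale_pos n
  refine ⟨min (18 * scale n) (19 * ε), by positivity, ?_, fun k x hx hxρ => ?_⟩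
  · exact (min_le_left _ _).trans_lt (by linarith [scale_le_one n])
  have h1 := hxρ.trans_le (min_le_left _ _)
  have h2 := hxρ.trans_le (min_le_right _ _)
  refine ⟨?_, by linarith [hx.1]⟩
  by_contra! hk
  linarith [scale_le_half hk, hx.1]

namespace Blocks

variable {E : ℝ → ℝ} {q : ℕ → ℕ} {α l M : ℕ → ℝ}

theorem exists_iteratedDeriv_baseField_le (h : Blocks E q α l M) (n : ℕ) {ε : ℝ} (hε : 0 < ε) :
    ∃ ρ > 0, ∀ x, 0 < x → x < ρ → ∀ j ≤ n, |iteratedDeriv j (baseField E l) x| ≤ ε := by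
  obtain ⟨ρ, hρ, hE⟩ := h.env.exists_iteratedDeriv_le n (half_pos hε)
  obtain ⟨ρ', hρ', h19, hs⟩ := exists_scale_le_of_lt n (half_pos hε)
  refine ⟨min ρ ρ', lt_min hρ hρ', fun x hx hxρ j hj => ?_⟩
  have h1 := hxρ.trans_le (min_le_left _ _)
  have h2 := hxρ.trans_le (min_le_right _ _)
  obtain ⟨k, hk⟩ := exists_mem_blockNhd hx (by linarith)
  obtain ⟨hnk, hsk⟩ := hs k x hk h2
  have hR : ContDiff ℝ ∞ (coreBump k : ℝ → ℝ) := (coreBump k).contDiff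
  have hj' : ((j : ℕ) : WithTop ℕ∞) ≤ ∞ := by exact_mod_cast le_top
  rw [(baseField_eventuallyEq E l hk).iteratedDeriv_eq,
    iteratedDeriv_fun_add (h.env.smooth.contDiffAt.of_le hj')
      ((contDiff_const.mul hR).contDiffAt.of_le hj'),
    iteratedDeriv_const_mul_field]
  have := (h.block k).bump_le j (by omega) x
  refine (abs_add_le _ _).trans ?_
  rw [abs_mul, abs_of_pos (h.block k).l_pos]
  linarith [hE x hx h1 j hj]

theorem blockField_eventuallyEq (E : ℝ → ℝ) (q : ℕ → ℕ) (α l : ℕ → ℝ) {k : ℕ} {x : ℝ}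
    (hx : x ∈ blockNhd k) : blockField E q α l =ᶠ[𝓝 x] fun y =>
      (deriv (twist (blockCutoff k) (α k) (2 * Real.pi * q k) (localChart E l k)) y)⁻¹ := by
  filter_upwards [(isOpen_blockNhd k).mem_nhds hx] with y hy
  rw [blockField_of_pos E q α l (pos_of_mem_blockNhd hy), deriv_blockChart_eq E q α l hy]

theorem exists_iteratedDeriv_blockField_le (h : Blocks E q α l M) (n : ℕ) {ε : ℝ} (hε : 0 < ε) :
    ∃ ρ > 0, ∀ k x, x ∈ blockNhd k → x ∉ Ioo (27 * scale k) (33 * scale k) → x < ρ → ∀ j ≤ n,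
      |iteratedDeriv j (blockField E q α l) x| ≤ ε := by
  obtain ⟨ρ, hρ, hE⟩ := h.env.exists_iteratedDeriv_le n (half_pos hε)
  obtain ⟨ρ', hρ', h19, hs⟩ := exists_scale_le_of_lt n (half_pos hε)
  refine ⟨min ρ ρ', lt_min hρ hρ', fun k x hk hcore hxρ j hj => ?_⟩
  have h1 := hxρ.trans_le (min_le_left _ _)
  have h2 := hxρ.trans_le (min_le_right _ _)
  obtain ⟨hnk, hsk⟩ := hs k x hk h2
  rw [(blockField_eventuallyEq E q α l hk).iteratedDeriv_eq]
  have := ((h.block k).collar _ (fun y hy => h.hasDerivAt_localChart_collar k hy) x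
    ((collar_or_core hk).resolve_right hcore)).2 j (by omega)
  have h3 := hE x (pos_of_mem_blockNhd hk) h1 j hj
  rw [abs_le] at this h3 ⊢
  constructor <;> linarith

theorem blockField_core (h : Blocks E q α l M) {k : ℕ} {x : ℝ}
    (hx : x ∈ Ioo (24 * scale k) (36 * scale k)) : blockField E q α l x =
      baseField E l x / (1 + 2 * Real.pi * q k * α k *
        Real.cos (2 * Real.pi * q k * localChart E l k x)) := by
  rw [blockField_of_pos E q α l (by linarith [hx.1, scale_pos k]), h.deriv_blockChart_core hx,
    mul_inv, inv_inv, div_eq_mul_inv]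

theorem abs_blockField_core_le (h : Blocks E q α l M) {k : ℕ} {x : ℝ}
    (hx : x ∈ Ioo (24 * scale k) (36 * scale k)) : |blockField E q α l x| ≤ 2 * baseField E l x ∧
      |deriv (blockField E q α l) x| ≤ 2 * |deriv (baseField E l) x| + 4 * scale k := by
  have hx0 : 0 < x := by linarith [hx.1, scale_pos k]
  have hp := h.baseField_pos hx0
  set w := 2 * Real.pi * q k with hw
  have hw0 : 0 ≤ w := by positivity
  have hα := (h.block k).α_pos
  set D := 1 + w * α k * Real.cos (w * localChart E l k x) with hD
  have hD2 : 1 / 2 ≤ D := h.one_add_core_pos k _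
  have hDi : D⁻¹ ≤ 2 := by
    have := inv_anti₀ (by norm_num) hD2
    simpa using this
  have hDi0 : 0 < D⁻¹ := inv_pos.2 (by linarith)
  constructor
  · rw [h.blockField_core hx, ← hw, ← hD, div_eq_mul_inv, abs_of_pos (mul_pos hp hDi0)]
    nlinarith
  · have e : blockField E q α l =ᶠ[𝓝 x] fun y => baseField E l y *
        (1 + w * α k * Real.cos (w * localChart E l k y))⁻¹ := by
      filter_upwards [isOpen_Ioo.mem_nhds hx] with y hy
      rw [h.blockField_core hy, div_eq_mul_inv]
    have h1 : HasDerivAt (baseField E l) (deriv (baseField E l) x) x :=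
      ((h.contDiffOn_baseField.contDiffAt (Ioi_mem_nhds hx0)).differentiableAt
        (by simp)).hasDerivAt
    have h2 : HasDerivAt (fun y => 1 + w * α k * Real.cos (w * localChart E l k y))
        (w * α k * (-Real.sin (w * localChart E l k x) * (w * (baseField E l x)⁻¹))) x :=
      (((h.hasDerivAt_localChart k hx0).const_mul w).cos.const_mul _).const_add 1
    have h3 := h1.mul (h2.inv (by rw [← hD]; linarith))
    have h4 : deriv (blockField E q α l) x = deriv (baseField E l) x * D⁻¹ +
        w ^ 2 * α k * Real.sin (w * localChart E l k x) * (D⁻¹ * D⁻¹) := by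
      rw [e.deriv_eq]
      refine h3.deriv.trans ?_
      simp only [Pi.inv_apply]
      rw [← hD]
      have : D ≠ 0 := by linarith
      field_simp
    have hsin := Real.abs_sin_le_one (w * localChart E l k x)
    have hsq := (h.block k).α_sq_le
    rw [← hw] at hsq
    rw [h4]
    refine (abs_add_le _ _).trans (add_le_add ?_ ?_)
    · rw [abs_mul, abs_of_pos hDi0]
      nlinarith [abs_nonneg (deriv (baseField E l) x)]
    · rw [abs_mul, abs_mul, abs_of_pos (mul_pos hDi0 hDi0), abs_of_nonneg (by positivity)]
      have a1 : D⁻¹ * D⁻¹ ≤ 4 := by nlinarith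
      have a2 : w ^ 2 * α k * |Real.sin (w * localChart E l k x)| ≤ scale k := by
        have : 0 ≤ w ^ 2 * α k := by positivity
        nlinarith
      have a3 : 0 ≤ w ^ 2 * α k * |Real.sin (w * localChart E l k x)| := by positivity
      nlinarith [scale_pos k]

theorem exists_blockField_le (h : Blocks E q α l M) {ε : ℝ} (hε : 0 < ε) :
    ∃ ρ > 0, ∀ x, 0 < x → x < ρ → ∀ j ≤ 1, |iteratedDeriv j (blockField E q α l) x| ≤ ε := by
  obtain ⟨ρ₁, hρ₁, hc⟩ := h.exists_iteratedDeriv_blockField_le 1 hε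
  obtain ⟨ρ₂, hρ₂, hb⟩ := h.exists_iteratedDeriv_baseField_le 1 (show 0 < ε / 4 by positivity)
  obtain ⟨ρ₃, hρ₃, h19, hs⟩ := exists_scale_le_of_lt 0 (show 0 < ε / 8 by positivity)
  refine ⟨min ρ₁ (min ρ₂ ρ₃), by positivity, fun x hx hxρ j hj => ?_⟩
  rw [lt_min_iff, lt_min_iff] at hxρ
  obtain ⟨k, hk⟩ := exists_mem_blockNhd hx (by linarith)
  by_cases hcore : x ∈ Ioo (27 * scale k) (33 * scale k)
  · obtain ⟨b1, b2⟩ := h.abs_blockField_core_le (core_subset hcore)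
    have b3 := hb x hx hxρ.2.1 0 (by norm_num)
    have b4 := hb x hx hxρ.2.1 1 le_rfl
    rw [iteratedDeriv_zero] at b3
    rw [iteratedDeriv_one] at b4
    have b5 := (hs k x hk hxρ.2.2).2
    interval_cases j
    · rw [iteratedDeriv_zero]
      linarith [le_abs_self (baseField E l x)]
    · rw [iteratedDeriv_one]
      linarith
  · exact hc k x hk hcore hxρ.1 j hj

theorem contDiff_one_of_bounds {g : ℝ → ℝ} (h0 : ∀ x ≤ 0, g x = 0)
    (hg : ContDiffOn ℝ ∞ g (Ioi 0))
    (hb : ∀ ε > 0, ∃ ρ > 0, ∀ x, 0 < x → x < ρ → ∀ j ≤ 1, |iteratedDeriv j g x| ≤ ε) :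
    ContDiff ℝ 1 g := by
  refine contDiff_of_tendsto_iteratedDeriv 1 g h0 hg fun j hj => ?_
  rw [Metric.tendsto_nhds]
  intro ε hε
  obtain ⟨ρ, hρ, hb⟩ := hb (ε / 2) (half_pos hε)
  filter_upwards [Ioo_mem_nhdsGT hρ] with x hx
  rw [Real.dist_eq, sub_zero]
  linarith [hb x hx.1 hx.2 j hj]

theorem contDiff_blockField (h : Blocks E q α l M) : ContDiff ℝ 1 (blockField E q α l) :=
  contDiff_one_of_bounds (fun _ hx => blockField_of_nonpos E q α l hx) h.timeChart.contDiffOn_field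
    fun _ hε => h.exists_blockField_le hε

theorem baseField_of_nonpos (h : Blocks E q α l M) {x : ℝ} (hx : x ≤ 0) : baseField E l x = 0 := by
  rw [baseField_eq_of_forall E l fun k => Or.inl (by linarith [scale_pos k]), h.env.eq_zero x hx]

theorem contDiff_baseField (h : Blocks E q α l M) : ContDiff ℝ 1 (baseField E l) :=
  contDiff_one_of_bounds (fun _ hx => h.baseField_of_nonpos hx) h.contDiffOn_baseField
    fun _ hε => h.exists_iteratedDeriv_baseField_le 1 hε

end Blocks

/-- Near `0` the flow of a `C¹` field vanishing on the left moves points by a small proportion. -/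
theorem TimeChart.exists_abs_flow_sub_le {ξ S : ℝ → ℝ} (h : TimeChart ξ S) (hξ : ContDiff ℝ 1 ξ)
    (h0 : ∀ x ≤ 0, ξ x = 0) {c T : ℝ} (hc : 0 < c) (hc1 : c < 1) (hT : 0 < T) :
    ∃ ρ > 0, ∀ x, 0 < x → x < ρ → ∀ t, |t| ≤ T → |chartFlow S t x - x| ≤ c * x := by
  obtain ⟨ρ, hρ, hb⟩ := exists_le_mul_of_contDiff_one hξ h0 (κ := c / (2 * T)) (by positivity)
  refine ⟨ρ / 2, by positivity, fun x hx hxρ t ht => ?_⟩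
  refine h.abs_flow_sub_le hb (by positivity) hc hc1 hx (by linarith) ?_ ht
  apply le_of_eq
  field_simp

namespace Blocks

variable {E : ℝ → ℝ} {q : ℕ → ℕ} {α l M : ℕ → ℝ}

theorem blockChart_core (E : ℝ → ℝ) (q : ℕ → ℕ) (α l : ℕ → ℝ) {k : ℕ} {x : ℝ}
    (hx : x ∈ Ioo (24 * scale k) (36 * scale k)) : blockChart E q α l x =
      baseChart E l x + α k * Real.sin (2 * Real.pi * q k * localChart E l k x) := by
  have hu := scale_pos k
  rw [blockChart_eq E q α l (k := k) ⟨by linarith [hx.1], by linarith [hx.2]⟩, twist,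
    blockCutoff_eq_one hx.1.le hx.2.le, localChart]
  ring

/-- In the core of a block the oscillation does not affect the flow at times in `q⁻¹ℤ`. -/
theorem flow_eq_base_flow (h : Blocks E q α l M) {k : ℕ} (hq : 0 < q k) (p : ℤ) {x : ℝ}
    (hx : x ∈ Ioo (24 * scale k) (36 * scale k))
    (hy : chartFlow (baseChart E l) (p / q k) x ∈ Ioo (24 * scale k) (36 * scale k)) :
    chartFlow (blockChart E q α l) (p / q k) x = chartFlow (baseChart E l) (p / q k) x := by
  have hx0 : 0 < x := by linarith [hx.1, scale_pos k]
  refine h.timeChart.flow_eq hx0 (h.timeChart_base.flow_pos hx0 _) ?_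
  rw [blockChart_core E q α l hx, blockChart_core E q α l hy, localChart, localChart,
    h.timeChart_base.chart_flow hx0]
  have hq' : (q k : ℝ) ≠ 0 := by exact_mod_cast hq.ne'
  have e : 2 * Real.pi * q k * (baseChart E l x + p / q k - baseChart E l (30 * scale k)) =
      2 * Real.pi * q k * (baseChart E l x - baseChart E l (30 * scale k))
        + p * (2 * Real.pi) := by
    field_simp
    ring
  rw [e, Real.sin_add_int_mul_two_pi]
  ring

theorem abs_iteratedDeriv_blockField_le (h : Blocks E q α l M) {k : ℕ} {x : ℝ}
    (hx : x ∈ Icc (25 * scale k) (35 * scale k)) {j : ℕ} (hj : j ≤ k) :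
    |iteratedDeriv j (blockField E q α l) x| ≤ M k := by
  have hu := scale_pos k
  have hxW : x ∈ blockNhd k := ⟨by linarith [hx.1], by linarith [hx.2]⟩
  rw [(blockField_eventuallyEq E q α l hxW).iteratedDeriv_eq]
  refine (h.block k).field_le (localChart E l k) (sub_self _) (fun y hy => ?_) x hx j hj
  rw [← baseField_eq E l hy]
  exact h.hasDerivAt_localChart k (pos_of_mem_blockNhd hy)

/-- The displacement of the flow near `0`, on scales where `3` units of time move points little. -/
theorem exists_displacement_le (h : Blocks E q α l M) : ∃ ρ > 0, ∀ x, 0 < x → x < ρ → ∀ t, |t| ≤ 3 →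
    |chartFlow (blockChart E q α l) t x - x| ≤ 1 / 50 * x ∧
    |chartFlow (baseChart E l) t x - x| ≤ 1 / 50 * x := by
  obtain ⟨ρ₁, hρ₁, h₁⟩ := h.timeChart.exists_abs_flow_sub_le h.contDiff_blockField
    (fun _ hx => blockField_of_nonpos E q α l hx) (show (0 : ℝ) < 1 / 50 by norm_num) (by norm_num)
    (show (0 : ℝ) < 3 by norm_num)
  obtain ⟨ρ₂, hρ₂, h₂⟩ := h.timeChart_base.exists_abs_flow_sub_le h.contDiff_baseField
    (fun _ hx => h.baseField_of_nonpos hx) (show (0 : ℝ) < 1 / 50 by norm_num) (by norm_num)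
    (show (0 : ℝ) < 3 by norm_num)
  refine ⟨min ρ₁ ρ₂, lt_min hρ₁ hρ₂, fun x hx hxρ t ht => ?_⟩
  rw [lt_min_iff] at hxρ
  exact ⟨h₁ x hx hxρ.1 t ht, h₂ x hx hxρ.2 t ht⟩

theorem iteratedDeriv_flow_sub_le_of_not_core (h : Blocks E q α l M) (n : ℕ) {δ : ℝ} (hδ : 0 < δ)
    (hδ1 : δ ≤ 1) : ∃ ρ > 0, ∀ x, 0 < x → x < ρ →
      (∀ k, x ∉ Ioo (26 * scale k) (34 * scale k)) → ∀ t, |t| ≤ 1 → ∀ j ≤ n,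
      |iteratedDeriv j (fun y => chartFlow (blockChart E q α l) t y - y) x| ≤ δ := by
  obtain ⟨ρ₁, hρ₁, hd⟩ := h.exists_displacement_le
  have hη : 0 < δ / (2 * (n.factorial * 2 ^ n)) := by positivity
  obtain ⟨ρ₂, hρ₂, hc⟩ := h.exists_iteratedDeriv_blockField_le n hη
  refine ⟨min ρ₁ (min (ρ₂ / 2) 1), by positivity, fun x hx hxρ hcore t ht j hj => ?_⟩
  rw [lt_min_iff, lt_min_iff] at hxρ
  refine h.timeChart.abs_iteratedDeriv_flow_sub_le hx one_pos hδ1 (K := n)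
    (η := δ / (2 * (n.factorial * 2 ^ n))) ?_ (fun r hr i hi => ?_) ht hj
  · have : δ / (2 * (n.factorial * 2 ^ n)) * n.factorial * 2 ^ n * 1 = δ / 2 := by
      field_simp
    linarith
  · have hdisp := abs_le.1 (hd x hx hxρ.1 r (by linarith)).1
    have hpos := h.timeChart.flow_pos hx r
    set y := chartFlow (blockChart E q α l) r x
    obtain ⟨m, hm⟩ := exists_mem_blockNhd hpos (by linarith)
    refine hc m y hm (fun hy => hcore m ?_) (by linarith) i hi
    have := scale_pos m
    exact ⟨by linarith [hy.1], by linarith [hy.2]⟩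

theorem iteratedDeriv_flow_sub_le_of_core (h : Blocks E q α l M) {ε : ℕ → ℝ}
    (hq : ∀ k, 0 < q k) (hε : ∀ k, 0 < ε k) (hε1 : ∀ k, ε k ≤ 1)
    (hεM : ∀ k, M k * k.factorial * 2 ^ k * ε k < scale k) (n : ℕ) {δ : ℝ} (hδ : 0 < δ)
    (hδ1 : δ ≤ 1) : ∃ ρ > 0, ∀ x, 0 < x → x < ρ →
      ∀ k, x ∈ Ioo (26 * scale k) (34 * scale k) → ∀ t : ℝ, |t| ≤ 1 →
      (∃ p : ℤ, |t - p / q k| ≤ ε k) → ∀ j ≤ n,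
      |iteratedDeriv j (fun y => chartFlow (blockChart E q α l) t y - y) x| ≤ δ := by
  obtain ⟨ρ₁, hρ₁, hd⟩ := h.exists_displacement_le
  set N : ℝ := n.factorial * 2 ^ n with hN
  have hN1 : 1 ≤ N := by
    have h1 : (1 : ℝ) ≤ n.factorial := by exact_mod_cast Nat.one_le_iff_ne_zero.2 n.factorial_ne_zero
    have h2 : (1 : ℝ) ≤ 2 ^ n := one_le_pow₀ (by norm_num)
    exact one_le_mul_of_one_le_of_one_le h1 h2
  set δ' := δ / (2 * N) with hδ'
  have hδ'0 : 0 < δ' := by positivity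
  have hδ'1 : N * δ' = δ / 2 := by rw [hδ']; field_simp
  obtain ⟨ρ₂, hρ₂, hb⟩ := h.exists_iteratedDeriv_baseField_le n
    (show 0 < δ' / (4 * N) by positivity)
  obtain ⟨ρ₃, hρ₃, h19, hs⟩ := exists_scale_le_of_lt n (half_pos hδ)
  refine ⟨min (ρ₁ / 2) (min (ρ₂ / 4) ρ₃), by positivity, fun x hx hxρ k hk t ht ⟨p, hp⟩ j hj => ?_⟩
  rw [lt_min_iff, lt_min_iff] at hxρ
  obtain ⟨hx1, hx2, hx3⟩ := hxρ
  have hu := scale_pos k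
  obtain ⟨hnk, hsk⟩ := hs k x ⟨by linarith [hk.1], by linarith [hk.2]⟩ hx3
  set t' : ℝ := p / q k with ht'
  set s := t - t' with hs'
  have hs1 : |s| ≤ 1 := hp.trans (hε1 k)
  have ht2 : |t'| ≤ 2 := by
    have := abs_sub_abs_le_abs_sub t' t
    rw [abs_sub_comm] at this
    linarith
  have hdisp : ∀ z ∈ Ioo (26 * scale k) (34 * scale k), z < ρ₁ / 2 → ∀ r, |r| ≤ 1 →
      chartFlow (blockChart E q α l) r z ∈ Ioo (25 * scale k) (35 * scale k) := by
    intro z hz hzρ r hr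
    have := abs_le.1 (hd z (by linarith [hz.1]) (by linarith) r (by linarith)).1
    constructor <;> linarith [hz.1, hz.2]
  set f := chartFlow (blockChart E q α l) s with hf
  set g : ℝ → ℝ := fun y => chartFlow (baseChart E l) t' y - y with hg
  have hfx := hdisp x hk hx1 s hs1
  have hfx0 : 0 < f x := h.timeChart.flow_pos hx s
  have hfx2 : f x ≤ 2 * x := by
    have := abs_le.1 (hd x hx (by linarith) s (by linarith)).1
    linarith
  have hcomp : (fun y => chartFlow (blockChart E q α l) t y - y) =ᶠ[𝓝 x]
      fun y => g (f y) + (f y - y) := by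
    filter_upwards [isOpen_Ioo.mem_nhds hk, Iio_mem_nhds hx1] with z hz hzρ
    have hfz := hdisp z hz hzρ s hs1
    have hz0 : 0 < z := by linarith [hz.1]
    have hfz0 : 0 < f z := h.timeChart.flow_pos hz0 s
    have hfz2 : f z < ρ₁ := by
      have := abs_le.1 (hd z hz0 (by linarith [show z < ρ₁ / 2 from hzρ]) s (by linarith)).1
      linarith [show z < ρ₁ / 2 from hzρ]
    have hdb := abs_le.1 (hd (f z) hfz0 hfz2 t' (by linarith)).2
    have hfz' : f z ∈ Ioo (25 * scale k) (35 * scale k) := hfz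
    have := h.flow_eq_base_flow (hq k) p (x := f z)
      ⟨by linarith [hfz'.1], by linarith [hfz'.2]⟩
      ⟨by linarith [hfz'.1], by linarith [hfz'.2]⟩
    have e : chartFlow (blockChart E q α l) t z = chartFlow (baseChart E l) t' (f z) := by
      rw [← this, hf, ← h.timeChart.flow_add]
      congr 1
      rw [hs']; ring
    rw [e]
    simp only [hg]
    ring
  have hfs : ContDiffOn ℝ ∞ f (Ioi 0) := h.timeChart.contDiffOn_flow s
  have hgs : ContDiffOn ℝ ∞ g (Ioi 0) := (h.timeChart_base.contDiffOn_flow t').sub contDiffOn_id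
  have hmaps : MapsTo f (Ioi 0) (Ioi 0) := fun z hz => h.timeChart.flow_pos hz s
  have hgf : ContDiffOn ℝ ∞ (fun y => g (f y)) (Ioi 0) := hgs.comp hfs hmaps
  have hfi : ContDiffOn ℝ ∞ (fun y => f y - y) (Ioi 0) := hfs.sub contDiffOn_id
  have hle : ∀ i : ℕ, ((i : ℕ) : WithTop ℕ∞) ≤ ∞ := fun i => by exact_mod_cast le_top
  have hxn := Ioi_mem_nhds hx
  have hfb : ∀ i ≤ k, |iteratedDeriv i (fun y => f y - y) x| ≤ scale k := by
    intro i hi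
    refine h.timeChart.abs_iteratedDeriv_flow_sub_le hx (hε k) (scale_le_one k) (K := k)
      (η := M k) (hεM k) (fun r hr i hi => ?_) hp hi
    have := hdisp x hk hx1 r (hr.trans (hε1 k))
    exact h.abs_iteratedDeriv_blockField_le ⟨this.1.le, this.2.le⟩ hi
  have hgb : ∀ i ≤ n, |iteratedDeriv i g (f x)| ≤ δ' := by
    intro i hi
    refine h.timeChart_base.abs_iteratedDeriv_flow_sub_le hfx0 (show (0 : ℝ) < 2 by norm_num)
      (K := n) (η := δ' / (4 * N)) ?_ ?_ (fun r hr i hi => ?_) ht2 hi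
    · nlinarith
    · have : δ' / (4 * N) * n.factorial * 2 ^ n * 2 = δ' / 2 := by
        rw [mul_assoc _ (n.factorial : ℝ), ← hN]; field_simp; norm_num
      linarith
    · have := abs_le.1 (hd (f x) hfx0 (by linarith) r (by linarith)).2
      exact hb _ (h.timeChart_base.flow_pos hfx0 r) (by linarith) i hi
  rw [hcomp.iteratedDeriv_eq, iteratedDeriv_fun_add ((hgf.contDiffAt hxn).of_le (hle j))
    ((hfi.contDiffAt hxn).of_le (hle j))]
  have hA : |iteratedDeriv j (fun y => g (f y)) x| ≤ j.factorial * δ' * 2 ^ j := by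
    refine abs_iteratedDeriv_comp_le isOpen_Ioi isOpen_Ioi hgs hfs hmaps hx
      (fun i hi => hgb i (hi.trans hj)) (fun i hi1 hi => ?_)
    have e : f = fun y => (f y - y) + y := by ext; ring
    have hid : ContDiffAt ℝ i (fun y : ℝ => y) x := contDiffAt_id
    rw [e, iteratedDeriv_fun_add ((hfi.contDiffAt hxn).of_le (hle i)) hid]
    have h1 := hfb i (by omega)
    have h2 := abs_iteratedDeriv_id_le hi1 x
    have h3 : (2 : ℝ) ≤ 2 ^ i := le_self_pow₀ (by norm_num) (by omega)
    exact (abs_add_le _ _).trans (by linarith [scale_le_one k])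
  have hB : j.factorial * δ' * 2 ^ j ≤ N * δ' := by
    have h1 : (j.factorial : ℝ) ≤ n.factorial := by exact_mod_cast Nat.factorial_le hj
    have h2 : (2 : ℝ) ^ j ≤ 2 ^ n := pow_le_pow_right₀ (by norm_num) hj
    calc (j.factorial : ℝ) * δ' * 2 ^ j = j.factorial * 2 ^ j * δ' := by ring
      _ ≤ n.factorial * 2 ^ n * δ' := by gcongr
  refine (abs_add_le _ _).trans ?_
  linarith [hfb j (by omega)]

/-- The flow is smooth up to the boundary at all times well approximated by every `q k`. -/
theorem contDiff_flow (h : Blocks E q α l M) {ε : ℕ → ℝ}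
    (hq : ∀ k, 0 < q k) (hε : ∀ k, 0 < ε k) (hε1 : ∀ k, ε k ≤ 1)
    (hεM : ∀ k, M k * k.factorial * 2 ^ k * ε k < scale k) {t : ℝ} (ht : |t| ≤ 1)
    (hap : ∀ k, ∃ p : ℤ, |t - p / q k| ≤ ε k) :
    ContDiff ℝ ∞ (chartFlow (blockChart E q α l) t) := by
  have hg : ContDiff ℝ ∞ fun x => chartFlow (blockChart E q α l) t x - x := by
    rw [contDiff_infty]
    intro n
    refine contDiff_of_tendsto_iteratedDeriv n _ (fun x hx => ?_)
      ((h.timeChart.contDiffOn_flow t).sub contDiffOn_id) fun j hj => ?_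
    · rw [TimeChart.flow_of_nonpos hx, sub_self]
    · rw [Metric.tendsto_nhds]
      intro δ hδ
      have hδ' : 0 < min (δ / 2) 1 := by positivity
      obtain ⟨ρ₁, hρ₁, h₁⟩ := h.iteratedDeriv_flow_sub_le_of_not_core n hδ' (min_le_right _ _)
      obtain ⟨ρ₂, hρ₂, h₂⟩ := h.iteratedDeriv_flow_sub_le_of_core hq hε hε1 hεM n hδ'
        (min_le_right _ _)
      filter_upwards [Ioo_mem_nhdsGT (lt_min hρ₁ hρ₂)] with x hx
      have hx2 := lt_min_iff.1 hx.2
      rw [Real.dist_eq, sub_zero]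
      refine lt_of_le_of_lt ?_ ((min_le_left (δ / 2) 1).trans_lt (half_lt_self hδ))
      by_cases hc : ∃ k, x ∈ Ioo (26 * scale k) (34 * scale k)
      · obtain ⟨k, hk⟩ := hc
        exact h₂ x hx.1 hx2.2 k hk t ht (hap k) j hj
      · push Not at hc
        exact h₁ x hx.1 hx2.1 hc t ht j hj
  simpa using hg.add contDiff_id

end Blocks

theorem TimeChart.crHalfLineDiffeo {ξ S : ℝ → ℝ} (h : TimeChart ξ S) {t : ℝ}
    (h1 : ContDiff ℝ ∞ (chartFlow S t)) (h2 : ContDiff ℝ ∞ (chartFlow S (-t))) :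
    CrHalfLineDiffeo ⊤ (chartFlow S t) := by
  have hl : ∀ x, chartFlow S (-t) (chartFlow S t x) = x := fun x => by
    rw [← h.flow_add, neg_add_cancel, h.flow_zero]
  have hr : ∀ x, chartFlow S t (chartFlow S (-t) x) = x := fun x => by
    rw [← h.flow_add, add_neg_cancel, h.flow_zero]
  have hbij : BijOn (chartFlow S t) (Ici 0) (Ici 0) :=
    ⟨fun x hx => h.flow_nonneg hx t, fun x _ y _ hxy => by rw [← hl x, hxy, hl y],
      fun y hy => ⟨_, h.flow_nonneg hy (-t), hr y⟩⟩
  refine ⟨⟨TimeChart.flow_of_nonpos le_rfl t, hbij, fun x hx => ?_, fun y hy => ?_⟩, h1.contDiffOn⟩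
  · rcases eq_or_lt_of_le (show 0 ≤ x from hx) with rfl | hx0
    · refine ⟨1, one_pos, ?_⟩
      have hd := (h1.differentiable (by simp) 0).hasDerivAt
      have hd1 : HasDerivWithinAt (chartFlow S t) 1 (Iic 0) 0 :=
        (hasDerivWithinAt_id (0 : ℝ) (Iic 0)).congr (fun x hx => TimeChart.flow_of_nonpos hx t)
          (TimeChart.flow_of_nonpos le_rfl t)
      rw [(uniqueDiffOn_Iic (0 : ℝ) 0 self_mem_Iic).eq_deriv _ hd.hasDerivWithinAt hd1] at hd
      exact hd.hasDerivWithinAt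
    · exact ⟨_, div_pos (h.pos _ (h.flow_pos hx0 t)) (h.pos x hx0),
        (h.hasDerivAt_flow hx0 t).hasDerivWithinAt⟩
  · have e : ∀ z ∈ Ici (0 : ℝ),
        Function.invFunOn (chartFlow S t) (Ici 0) z = chartFlow S (-t) z := by
      intro z hz
      have hz' := hbij.surjOn hz
      refine hbij.injOn (Function.invFunOn_mem hz') (h.flow_nonneg hz _) ?_
      rw [Function.invFunOn_eq hz', hr]
    exact ⟨_, (h2.differentiable (by simp) y).hasDerivAt.hasDerivWithinAt.congr e (e y hy)⟩

theorem TimeChart.contDiff_flow_of_mem_closure {ξ S : ℝ → ℝ} (h : TimeChart ξ S) {s : Set ℝ}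
    (hs : ∀ t ∈ s, ContDiff ℝ ∞ (chartFlow S t) ∧ ContDiff ℝ ∞ (chartFlow S (-t))) {t : ℝ}
    (ht : t ∈ AddSubgroup.closure s) :
    ContDiff ℝ ∞ (chartFlow S t) ∧ ContDiff ℝ ∞ (chartFlow S (-t)) := by
  have hadd : ∀ a b, chartFlow S (a + b) = chartFlow S a ∘ chartFlow S b := fun a b =>
    funext fun x => h.flow_add a b x
  induction ht using AddSubgroup.closure_induction with
  | mem x hx => exact hs x hx
  | zero =>
    have : chartFlow S 0 = id := funext h.flow_zero
    rw [neg_zero, this]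
    exact ⟨contDiff_id, contDiff_id⟩
  | add x y _ _ hx hy =>
    rw [neg_add, hadd, hadd]
    exact ⟨hx.1.comp hy.1, hx.2.comp hy.2⟩
  | neg x _ hx => rw [neg_neg]; exact ⟨hx.2, hx.1⟩

theorem TimeChart.isFlowOf {ξ S : ℝ → ℝ} (h : TimeChart ξ S) (h0 : ξ 0 = 0) :
    IsFlowOf ξ (chartFlow S) := by
  intro x hx
  refine ⟨h.flow_zero x, fun t => ⟨h.flow_nonneg hx t, ?_⟩⟩
  rcases eq_or_lt_of_le (show 0 ≤ x from hx) with rfl | hx0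
  · have e : ∀ s, chartFlow S s 0 = 0 := fun s => TimeChart.flow_of_nonpos le_rfl s
    simp only [e, h0]
    exact hasDerivAt_const t 0
  · exact h.hasDerivAt_flow_time hx0 t

namespace Blocks

variable {E : ℝ → ℝ} {q : ℕ → ℕ} {α l M : ℕ → ℝ}

theorem baseField_center (h : Blocks E q α l M) {k : ℕ} {x : ℝ}
    (hx : x ∈ Ioo (29 * scale k) (31 * scale k)) : baseField E l x = l k := by
  have hu := scale_pos k
  rw [baseField_eq E l (k := k) ⟨by linarith [hx.1], by linarith [hx.2]⟩,
    h.env.core k x hx.1.le hx.2.le, coreBump_eq_one hx.1.le hx.2.le, zero_add, mul_one]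

theorem localChart_center (h : Blocks E q α l M) {k : ℕ} {r : ℝ} (hr : |r| < scale k) :
    localChart E l k (30 * scale k + r) = r / l k := by
  have hu := scale_pos k
  rw [abs_lt] at hr
  have hlin : ∀ x ∈ Ioo (29 * scale k) (31 * scale k),
      HasDerivAt (fun x => (x - 30 * scale k) / l k) (l k)⁻¹ x := fun x _ => by
    simpa using ((hasDerivAt_id x).sub_const (30 * scale k)).div_const (l k)
  have := eq_add_of_hasDerivAt_eq (f := localChart E l k) (fun x hx => by
    rw [← h.baseField_center hx]
    exact h.hasDerivAt_localChart k (by linarith [hx.1])) hlin (m := 30 * scale k)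
    (x := 30 * scale k + r) ⟨by linarith, by linarith⟩ ⟨by linarith, by linarith⟩
  rw [this, localChart]
  simp

/-- The derivatives of the time-`1/2` map at two nearby points of the core of a block. -/
theorem deriv_flow_half_center (h : Blocks E q α l M) {k : ℕ} (hq : Odd (q k)) :
    deriv (chartFlow (blockChart E q α l) (1 / 2)) (30 * scale k) =
      (1 + 2 * Real.pi * q k * α k) / (1 - 2 * Real.pi * q k * α k) ∧
    deriv (chartFlow (blockChart E q α l) (1 / 2)) (30 * scale k + l k / 2) =
      (1 - 2 * Real.pi * q k * α k) / (1 + 2 * Real.pi * q k * α k) := by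
  have hu := scale_pos k
  have hl := (h.block k).l_pos
  have hls := (h.block k).l_le_scale
  have hb := (h.block k).α_le
  have hα := (h.block k).α_pos
  set b := 2 * Real.pi * q k * α k with hbdef
  have hb0 : 0 ≤ b := by positivity
  obtain ⟨m, hm⟩ := hq
  have hπ1 : 2 * Real.pi * q k * (l k / 2 / l k) = Real.pi + (m : ℕ) * (2 * Real.pi) := by
    rw [hm]; push_cast; field_simp; ring
  have hπ2 : 2 * Real.pi * q k * (l k / l k) = (q k : ℕ) * (2 * Real.pi) := by
    field_simp
  have hcoord : ∀ r, 0 ≤ r → r ≤ l k → 30 * scale k + r ∈ Ioo (29 * scale k) (31 * scale k) ∧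
      30 * scale k + r ∈ Ioo (24 * scale k) (36 * scale k) ∧ 0 < 30 * scale k + r ∧
      localChart E l k (30 * scale k + r) = r / l k := fun r h0 h1 =>
    ⟨⟨by linarith, by linarith⟩, ⟨by linarith, by linarith⟩, by linarith,
      h.localChart_center (by rw [abs_of_nonneg h0]; linarith)⟩
  have hS : ∀ r, 0 ≤ r → r ≤ l k → blockChart E q α l (30 * scale k + r) =
      baseChart E l (30 * scale k) + r / l k
        + α k * Real.sin (2 * Real.pi * q k * (r / l k)) := by
    intro r h0 h1
    obtain ⟨c1, c2, c3, c4⟩ := hcoord r h0 h1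
    rw [blockChart_core E q α l c2, c4, ← c4, localChart]
    ring
  have hξ : ∀ r, 0 ≤ r → r ≤ l k → blockField E q α l (30 * scale k + r) =
      l k / (1 + b * Real.cos (2 * Real.pi * q k * (r / l k))) := by
    intro r h0 h1
    obtain ⟨c1, c2, c3, c4⟩ := hcoord r h0 h1
    rw [h.blockField_core c2, c4, h.baseField_center c1]
  obtain ⟨-, -, p0, -⟩ := hcoord 0 le_rfl hl.le
  obtain ⟨-, -, p1, -⟩ := hcoord (l k / 2) (by linarith) (by linarith)
  obtain ⟨-, -, p2, -⟩ := hcoord (l k) hl.le le_rfl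
  have S0 := hS 0 le_rfl hl.le
  have S1 := hS (l k / 2) (by linarith) (by linarith)
  have S2 := hS (l k) hl.le le_rfl
  have X0 := hξ 0 le_rfl hl.le
  have X1 := hξ (l k / 2) (by linarith) (by linarith)
  have X2 := hξ (l k) hl.le le_rfl
  rw [hπ1, Real.sin_add_nat_mul_two_pi, Real.sin_pi] at S1
  rw [hπ2, ← zero_add ((q k : ℕ) * (2 * Real.pi)), Real.sin_add_nat_mul_two_pi, Real.sin_zero] at S2
  rw [hπ1, Real.cos_add_nat_mul_two_pi, Real.cos_pi] at X1
  rw [hπ2, ← zero_add ((q k : ℕ) * (2 * Real.pi)), Real.cos_add_nat_mul_two_pi, Real.cos_zero] at X2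
  simp only [add_zero, zero_div, mul_zero, Real.sin_zero, Real.cos_zero] at S0 X0 p0
  have F0 : chartFlow (blockChart E q α l) (1 / 2) (30 * scale k) = 30 * scale k + l k / 2 := by
    refine h.timeChart.flow_eq p0 p1 ?_
    rw [S0, S1]
    field_simp
    ring
  have F1 : chartFlow (blockChart E q α l) (1 / 2) (30 * scale k + l k / 2) =
      30 * scale k + l k := by
    refine h.timeChart.flow_eq p1 p2 ?_
    rw [S1, S2]
    field_simp
    ring
  have n1 : 1 + b ≠ 0 := by linarith
  have n2 : 1 - b ≠ 0 := by linarith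
  rw [mul_one] at X0 X2
  rw [mul_neg_one, ← sub_eq_add_neg] at X1
  constructor
  · rw [(h.timeChart.hasDerivAt_flow p0 _).deriv, F0, X0, X1]
    field_simp
  · rw [(h.timeChart.hasDerivAt_flow p1 _).deriv, F1, X1, X2]
    field_simp

theorem not_contDiffWithinAt_flow_half (h : Blocks E q α l M) (hq : ∀ k, Odd (q k)) :
    ¬ ContDiffWithinAt ℝ 2 (chartFlow (blockChart E q α l) (1 / 2)) (Ici 0) 0 := by
  intro hF
  set f := chartFlow (blockChart E q α l) (1 / 2) with hf
  have h1 : ContDiffWithinAt ℝ 1 (fun x => fderivWithin ℝ f (Ici 0) x 1) (Ici 0) 0 :=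
    hF.fderivWithin_right_apply contDiffWithinAt_const (uniqueDiffOn_Ici 0) (by norm_num)
      self_mem_Ici
  obtain ⟨C, s, hs, hL⟩ := h1.exists_lipschitzOnWith (convex_Ici 0)
  rw [Metric.mem_nhdsWithin_iff] at hs
  obtain ⟨ρ, hρ, hs⟩ := hs
  have hd : ∀ x, 0 < x → x < ρ → x ∈ s ∧ fderivWithin ℝ f (Ici 0) x 1 = deriv f x := by
    intro x hx hxρ
    refine ⟨hs ⟨by rwa [Metric.mem_ball, Real.dist_eq, sub_zero, abs_of_pos hx], hx.le⟩, ?_⟩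
    rw [fderivWithin_of_mem_nhds (Ici_mem_nhds hx), fderiv_apply_one_eq_deriv]
  have hev : ∀ᶠ k in atTop, scale k < ρ / 31 :=
    tendsto_scale.eventually (gt_mem_nhds (by positivity))
  obtain ⟨k, hk1, hk2⟩ := (hev.and (eventually_ge_atTop ⌈(C : ℝ)⌉₊)).exists
  have hkC : (C : ℝ) ≤ k := (Nat.le_ceil _).trans (by exact_mod_cast hk2)
  have hu := scale_pos k
  have hl := (h.block k).l_pos
  have hls := (h.block k).l_le_scale
  have hlb := (h.block k).l_le
  have hb := (h.block k).α_le
  obtain ⟨d0, d1⟩ := h.deriv_flow_half_center (hq k)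
  set b := 2 * Real.pi * q k * α k
  obtain ⟨m0, e0⟩ := hd (30 * scale k) (by linarith) (by linarith)
  obtain ⟨m1, e1⟩ := hd (30 * scale k + l k / 2) (by linarith) (by linarith)
  have hdist := hL.dist_le_mul _ m0 _ m1
  rw [e0, e1, d0, d1, Real.dist_eq, Real.dist_eq] at hdist
  have hb0 : 0 < b := lt_of_lt_of_le (by positivity) hlb
  have e2 : |30 * scale k - (30 * scale k + l k / 2)| = l k / 2 := by
    rw [show 30 * scale k - (30 * scale k + l k / 2) = -(l k / 2) by ring, abs_neg,
      abs_of_pos (by positivity)]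
  have e3 : (1 + b) / (1 - b) - (1 - b) / (1 + b) ≥ 4 * b := by
    have n1 : 0 < 1 - b := by linarith
    have n2 : 0 < 1 + b := by linarith
    have : (1 + b) / (1 - b) - (1 - b) / (1 + b) = 4 * b / ((1 - b) * (1 + b)) := by
      field_simp
      ring
    rw [this, ge_iff_le, le_div_iff₀ (by positivity)]
    nlinarith [mul_pos hb0 (mul_pos hb0 hb0)]
  rw [e2] at hdist
  have e4 := (e3.le.trans (le_abs_self _)).trans hdist
  nlinarith

end Blocks

/-- The real number `∑ₖ (1 + aₖ) / qₖ`, where the binary digits `aₖ` are `0` or `1`. -/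
noncomputable def digitSum (q : ℕ → ℕ) (a : ℕ → Bool) : ℝ :=
  ∑' k, (1 + (a k).toNat : ℝ) / q k

/-- Denominators `q 0 ∣ q 1 ∣ …` growing superexponentially. -/
structure Lacunary (q : ℕ → ℕ) : Prop where
  zero_ge : 9 ≤ q 0
  dvd : ∀ k, q k ∣ q (k + 1)
  growth : ∀ k, 9 * (k + 1) * q k ≤ q (k + 1)

namespace Lacunary

variable {q : ℕ → ℕ}

theorem pos (h : Lacunary q) (k : ℕ) : 0 < q k := by
  induction k with
  | zero => exact lt_of_lt_of_le (by norm_num) h.zero_ge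
  | succ k ih => exact lt_of_lt_of_le (by positivity) (h.growth k)

theorem dvd_of_le (h : Lacunary q) {m n : ℕ} (hmn : m ≤ n) : q m ∣ q n := by
  induction n, hmn using Nat.le_induction with
  | base => exact dvd_rfl
  | succ n _ ih => exact ih.trans (h.dvd n)

theorem inv_add_le (h : Lacunary q) (n j : ℕ) :
    (1 : ℝ) / q (j + n) ≤ 1 / q n * (1 / 9) ^ j := by
  induction j with
  | zero => simp
  | succ j ih =>
    have h1 := h.growth (j + n)
    have hp : (0 : ℝ) < q (j + n) := by exact_mod_cast h.pos _
    have h2 : (9 : ℝ) * q (j + n) ≤ q (j + 1 + n) := by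
      rw [add_right_comm j 1 n]
      have : 9 * q (j + n) ≤ q (j + n + 1) := by nlinarith [h.pos (j + n)]
      exact_mod_cast this
    calc (1 : ℝ) / q (j + 1 + n) ≤ 1 / (9 * q (j + n)) := by gcongr
      _ = 1 / q (j + n) * (1 / 9) := by field_simp
      _ ≤ 1 / q n * (1 / 9) ^ j * (1 / 9) := by gcongr
      _ = _ := by ring

theorem digit_term_le (h : Lacunary q) (a : ℕ → Bool) (n j : ℕ) :
    (1 + (a (j + n)).toNat : ℝ) / q (j + n) ≤ 2 / q n * (1 / 9) ^ j := by
  have h1 : (1 + (a (j + n)).toNat : ℝ) ≤ 2 := by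
    cases a (j + n) <;> norm_num
  have h2 := h.inv_add_le n j
  calc (1 + (a (j + n)).toNat : ℝ) / q (j + n) ≤ 2 / q (j + n) := by gcongr
    _ = 2 * (1 / q (j + n)) := by ring
    _ ≤ 2 * (1 / q n * (1 / 9) ^ j) := by gcongr
    _ = _ := by ring

theorem hasSum_bound (c : ℕ) : HasSum (fun j : ℕ => (2 / c * (1 / 9) ^ j : ℝ)) (9 / 4 / c) := by
  have := (hasSum_geometric_of_lt_one (r := (1 / 9 : ℝ)) (by norm_num) (by norm_num)).mul_left
    (2 / c : ℝ)
  rwa [show (2 / c * (1 - 1 / 9)⁻¹ : ℝ) = 9 / 4 / c by norm_num; ring] at this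

theorem summable_tail (h : Lacunary q) (a : ℕ → Bool) (n : ℕ) :
    Summable fun j => (1 + (a (j + n)).toNat : ℝ) / q (j + n) :=
  Summable.of_nonneg_of_le (fun j => by positivity) (h.digit_term_le a n)
    (hasSum_bound (q n)).summable

theorem tail_pos (h : Lacunary q) (a : ℕ → Bool) (n : ℕ) :
    0 < ∑' j, (1 + (a (j + n)).toNat : ℝ) / q (j + n) := by
  refine (h.summable_tail a n).tsum_pos (fun j => by positivity) 0 ?_
  have := h.pos (0 + n)
  positivity

theorem tail_le (h : Lacunary q) (a : ℕ → Bool) (n : ℕ) :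
    ∑' j, (1 + (a (j + n)).toNat : ℝ) / q (j + n) ≤ 9 / 4 / q n :=
  ((h.summable_tail a n).tsum_le_tsum (h.digit_term_le a n) (hasSum_bound (q n)).summable).trans_eq
    (hasSum_bound (q n)).tsum_eq

theorem digitSum_eq (h : Lacunary q) (a : ℕ → Bool) (n : ℕ) :
    digitSum q a = ∑ j ∈ Finset.range n, (1 + (a j).toNat : ℝ) / q j +
      ∑' j, (1 + (a (j + n)).toNat : ℝ) / q (j + n) :=
  ((h.summable_tail a 0).sum_add_tsum_nat_add n).symm

theorem digitSum_mem_Icc (h : Lacunary q) (a : ℕ → Bool) : digitSum q a ∈ Icc 0 1 := by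
  have h0 := h.digitSum_eq a 0
  rw [Finset.sum_range_zero, zero_add] at h0
  rw [h0]
  refine ⟨(h.tail_pos a 0).le, (h.tail_le a 0).trans ?_⟩
  have : (9 : ℝ) ≤ q 0 := by exact_mod_cast h.zero_ge
  rw [div_le_one (by linarith)]
  linarith

theorem exists_partialSum_eq (h : Lacunary q) (a : ℕ → Bool) (n : ℕ) :
    ∃ p : ℤ, ∑ j ∈ Finset.range (n + 1), (1 + (a j).toNat : ℝ) / q j = p / q n := by
  refine ⟨(∑ j ∈ Finset.range (n + 1), (1 + (a j).toNat) * (q n / q j) : ℕ), ?_⟩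
  rw [Int.cast_natCast, Nat.cast_sum, Finset.sum_div]
  refine Finset.sum_congr rfl fun j hj => ?_
  have p1 : (q j : ℝ) ≠ 0 := by exact_mod_cast (h.pos j).ne'
  have p2 : (q n : ℝ) ≠ 0 := by exact_mod_cast (h.pos n).ne'
  rw [Nat.cast_mul, Nat.cast_div (h.dvd_of_le (Nat.lt_succ_iff.1 (Finset.mem_range.1 hj))) p1]
  push_cast
  field_simp

theorem exists_approx (h : Lacunary q) (a : ℕ → Bool) (n : ℕ) :
    ∃ p : ℤ, 0 < digitSum q a - p / q n ∧ digitSum q a - p / q n ≤ 9 / 4 / q (n + 1) := by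
  obtain ⟨p, hp⟩ := h.exists_partialSum_eq a n
  refine ⟨p, ?_⟩
  rw [h.digitSum_eq a (n + 1), hp, add_sub_cancel_left]
  exact ⟨h.tail_pos a _, h.tail_le a _⟩

theorem irrational_digitSum (h : Lacunary q) (a : ℕ → Bool) : Irrational (digitSum q a) := by
  rintro ⟨x, hx⟩
  obtain ⟨p, hp0, hp1⟩ := h.exists_approx a x.den
  have d0 : (0 : ℝ) < x.den := by exact_mod_cast x.den_pos
  have q0 : (0 : ℝ) < q x.den := by exact_mod_cast h.pos _
  have q1 : (0 : ℝ) < q (x.den + 1) := by exact_mod_cast h.pos _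
  have hg : (9 : ℝ) * (x.den + 1) * q x.den ≤ q (x.den + 1) := by exact_mod_cast h.growth x.den
  have e : (digitSum q a - p / q x.den) * (x.den * q x.den) =
      ((x.num * q x.den - p * x.den : ℤ) : ℝ) := by
    rw [← hx, Rat.cast_def]
    push_cast
    field_simp
  have i0 : (0 : ℝ) < ((x.num * q x.den - p * x.den : ℤ) : ℝ) := by
    rw [← e]; positivity
  have i1 : (1 : ℝ) ≤ ((x.num * q x.den - p * x.den : ℤ) : ℝ) := by
    exact_mod_cast Int.add_one_le_iff.2 (Int.cast_pos.1 i0)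
  rw [← e] at i1
  have : (1 : ℝ) ≤ 9 / 4 / q (x.den + 1) * (x.den * q x.den) :=
    i1.trans (by gcongr)
  rw [div_mul_eq_mul_div, le_div_iff₀ q1] at this
  nlinarith [mul_pos d0 q0]

theorem digitSum_injective (h : Lacunary q) : Function.Injective (digitSum q) := by
  intro a b hab
  by_contra hne
  have hex : ∃ n, a n ≠ b n := Function.ne_iff.1 hne
  classical
  have hn := Nat.find_spec hex
  have hlt : ∀ m < Nat.find hex, a m = b m := fun m hm => not_not.1 (Nat.find_min hex hm)
  set n := Nat.find hex
  have ea := h.digitSum_eq a (n + 1)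
  have eb := h.digitSum_eq b (n + 1)
  rw [Finset.sum_range_succ] at ea eb
  have es : ∑ j ∈ Finset.range n, (1 + (a j).toNat : ℝ) / q j =
      ∑ j ∈ Finset.range n, (1 + (b j).toNat : ℝ) / q j :=
    Finset.sum_congr rfl fun j hj => by rw [hlt j (Finset.mem_range.1 hj)]
  have ta := h.tail_pos a (n + 1)
  have tb := h.tail_pos b (n + 1)
  have ta' := h.tail_le a (n + 1)
  have tb' := h.tail_le b (n + 1)
  have q0 : (0 : ℝ) < q n := by exact_mod_cast h.pos n
  have hb : (9 : ℝ) / 4 / q (n + 1) < 1 / q n := by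
    have h1 : (9 : ℝ) * (n + 1) * q n ≤ q (n + 1) := by exact_mod_cast h.growth n
    have q1 : (0 : ℝ) < q (n + 1) := by exact_mod_cast h.pos _
    rw [div_lt_div_iff₀ q1 q0]
    nlinarith [mul_nonneg (Nat.cast_nonneg (α := ℝ) n) q0.le]
  have e1 : (1 + (1 : ℕ) : ℝ) / q n = 1 / q n + 1 / q n := by push_cast; ring
  have e0 : (1 + (0 : ℕ) : ℝ) / q n = 1 / q n := by push_cast; ring
  rcases ha : a n with _ | _ <;> rcases hb' : b n with _ | _ <;>
    simp only [ha, hb', ne_eq, not_true_eq_false, Bool.toNat_true, Bool.toNat_false, e0, e1]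
      at hn ea eb <;>
    linarith

theorem continuous_digitSum (h : Lacunary q) : Continuous (digitSum q) := by
  refine continuous_tsum (u := fun j => (2 : ℝ) / q 0 * (1 / 9) ^ j) (fun k => ?_)
    (hasSum_bound (q 0)).summable fun k a => ?_
  · have : Continuous fun b : Bool => (1 + b.toNat : ℝ) / q k := continuous_of_discreteTopology
    exact this.comp (continuous_apply k)
  · rw [Real.norm_of_nonneg (by positivity)]
    exact h.digit_term_le a 0 k

theorem tendsto_update_not (a : ℕ → Bool) :
    Tendsto (fun n => Function.update a n (!a n)) atTop (𝓝 a) := by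
  refine tendsto_pi_nhds.2 fun k => tendsto_const_nhds.congr' ?_
  filter_upwards [eventually_gt_atTop k] with n hn
  rw [Function.update_of_ne hn.ne]

theorem perfect_range_digitSum (h : Lacunary q) : Perfect (range (digitSum q)) := by
  refine ⟨(isCompact_range h.continuous_digitSum).isClosed, ?_⟩
  rintro _ ⟨a, rfl⟩
  rw [accPt_iff_frequently]
  have ht := (h.continuous_digitSum.tendsto a).comp (tendsto_update_not a)
  refine ht.frequently (Frequently.of_forall fun n => ⟨fun he => ?_, mem_range_self _⟩)
  have := congrFun (h.digitSum_injective he) n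
  simp at this

theorem isTotallyDisconnected_range_digitSum (h : Lacunary q) :
    IsTotallyDisconnected (range (digitSum q)) := by
  have he : IsEmbedding (digitSum q) :=
    (h.continuous_digitSum.isClosedEmbedding h.digitSum_injective).isEmbedding
  exact he.isTotallyDisconnected_range.2 inferInstance

end Lacunary

theorem exists_lacunary (ε : ℕ → ℕ → ℝ) (hε : ∀ k n, 0 < ε k n) :
    ∃ q : ℕ → ℕ, Lacunary q ∧ (∀ k, Odd (q k)) ∧ ∀ k, 9 / 4 / q (k + 1) ≤ ε k (q k) := by
  have step : ∀ k n : ℕ, ∃ m : ℕ, Odd m ∧ 9 * (k + 1) ≤ m ∧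
      (0 < n → 9 / 4 / (m * n : ℝ) ≤ ε k n) := by
    intro k n
    obtain ⟨N, hN⟩ := exists_nat_gt (9 / 4 / ε k n)
    refine ⟨2 * (9 * (k + 1) + N) + 1, ⟨_, rfl⟩, by omega, fun hn => ?_⟩
    have h1 : (1 : ℝ) ≤ n := by exact_mod_cast hn
    rw [div_lt_iff₀ (hε k n)] at hN
    rw [div_le_iff₀ (by positivity)]
    push_cast
    have e := hε k n
    have h2 : (N : ℝ) ≤ (2 * (9 * (k + 1) + N) + 1) * n := by
      have : (N : ℝ) ≤ 2 * (9 * (k + 1) + N) + 1 := by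
        have := Nat.cast_nonneg (α := ℝ) k
        have := Nat.cast_nonneg (α := ℝ) N
        linarith
      nlinarith [Nat.cast_nonneg (α := ℝ) N]
    nlinarith
  choose m hodd hm hsmall using step
  let q : ℕ → ℕ := fun k => Nat.rec 9 (fun k n => m k n * n) k
  have hq : ∀ k, q (k + 1) = m k (q k) * q k := fun k => rfl
  have hl : Lacunary q :=
    ⟨le_rfl, fun k => ⟨_, (hq k).trans (mul_comm _ _)⟩, fun k => by
      rw [hq]; exact Nat.mul_le_mul_right _ (hm _ _)⟩
  refine ⟨q, hl, fun k => ?_, fun k => ?_⟩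
  · induction k with
    | zero => exact ⟨4, rfl⟩
    | succ k ih => rw [hq]; exact (hodd _ _).mul ih
  · rw [hq]
    push_cast
    exact hsmall k _ (hl.pos k)

theorem Blocks.exists_lacunary_blocks :
    ∃ (E : ℝ → ℝ) (q : ℕ → ℕ) (α l M ε : ℕ → ℝ), Blocks E q α l M ∧ Lacunary q ∧
      (∀ k, Odd (q k)) ∧ (∀ k, 0 < ε k) ∧ (∀ k, ε k ≤ 1) ∧
      (∀ k, M k * k.factorial * 2 ^ k * ε k < scale k) ∧
      ∀ k, 9 / 4 / q (k + 1) ≤ ε k := by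
  obtain ⟨E, hE⟩ := exists_envelope
  have hblock : ∀ k n : ℕ, ∃ α l M : ℝ, 0 < n → BlockData E k n α l M := by
    intro k n
    rcases Nat.eq_zero_or_pos n with rfl | hn
    · exact ⟨0, 0, 0, fun h => absurd h (lt_irrefl 0)⟩
    · obtain ⟨α, l, M, h⟩ := hE.exists_blockData k hn
      exact ⟨α, l, M, fun _ => h⟩
  choose α l M hB using hblock
  have htol : ∀ k n : ℕ, ∃ ε : ℝ, 0 < ε ∧ ε ≤ 1 ∧
      M k n * k.factorial * 2 ^ k * ε < scale k := by
    intro k n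
    have hs := scale_pos k
    have hc : 0 < |M k n * k.factorial * 2 ^ k| + scale k := by positivity
    refine ⟨scale k / (|M k n * k.factorial * 2 ^ k| + scale k), by positivity,
      (div_le_one hc).2 (le_add_of_nonneg_left (abs_nonneg _)), ?_⟩
    rw [mul_div_assoc', div_lt_iff₀ hc]
    nlinarith [le_abs_self (M k n * k.factorial * 2 ^ k)]
  choose ε hε0 hε1 hεM using htol
  obtain ⟨q, hq, hodd, hqε⟩ := exists_lacunary ε hε0
  exact ⟨E, q, fun k => α k (q k), fun k => l k (q k), fun k => M k (q k), fun k => ε k (q k),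
    ⟨hE, fun k => hB k _ (hq.pos k)⟩, hq, hodd, fun k => hε0 k _, fun k => hε1 k _,
    fun k => hεM k _, hqε⟩

/-- There is a complete `C^1` vector field `ξ` on `[0,∞)`, vanishing exactly at `0`, and a
Cantor set `K` of irrational numbers, such that the time-`1/2` map of the flow of `ξ` is not
`C^2` at `0`, while the time-`t` map is a smooth diffeomorphism of `[0,∞)` for every `t` in
the additive subgroup of `ℝ` generated by `1` and the elements of `K`. -/
theorem statement1 :
    ∃ (ξ : ℝ → ℝ) (F : ℝ → ℝ → ℝ) (K : Set ℝ),
      ContDiffOn ℝ 1 ξ (Set.Ici 0) ∧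
      (∀ x ∈ Set.Ici (0 : ℝ), (ξ x = 0 ↔ x = 0)) ∧
      IsFlowOf ξ F ∧
      K.Nonempty ∧ IsCompact K ∧ Perfect K ∧ IsTotallyDisconnected K ∧
      (∀ x ∈ K, Irrational x) ∧
      ¬ ContDiffWithinAt ℝ 2 (F (1 / 2)) (Set.Ici 0) 0 ∧
      (∀ t ∈ AddSubgroup.closure (insert (1 : ℝ) K), CrHalfLineDiffeo ⊤ (F t)) := by
  obtain ⟨E, q, α, l, M, ε, h, hq, hodd, hε0, hε1, hεM, hqε⟩ := Blocks.exists_lacunary_blocks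
  have hT := h.timeChart
  have hξ0 : blockField E q α l 0 = 0 := Blocks.blockField_of_nonpos E q α l le_rfl
  have hsmooth : ∀ t : ℝ, |t| ≤ 1 → (∀ k, ∃ p : ℤ, |t - p / q k| ≤ ε k) →
      ContDiff ℝ ∞ (chartFlow (blockChart E q α l) t) ∧
      ContDiff ℝ ∞ (chartFlow (blockChart E q α l) (-t)) := by
    intro t ht hap
    refine ⟨h.contDiff_flow hq.pos hε0 hε1 hεM ht hap,
      h.contDiff_flow hq.pos hε0 hε1 hεM (by rwa [abs_neg]) fun k => ?_⟩
    obtain ⟨p, hp⟩ := hap k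
    refine ⟨-p, ?_⟩
    rwa [Int.cast_neg, neg_div, ← neg_sub', abs_neg]
  have hgen : ∀ t ∈ insert (1 : ℝ) (range (digitSum q)),
      ContDiff ℝ ∞ (chartFlow (blockChart E q α l) t) ∧
      ContDiff ℝ ∞ (chartFlow (blockChart E q α l) (-t)) := by
    rintro t (rfl | ⟨a, rfl⟩)
    · refine hsmooth 1 (by simp) fun k => ⟨q k, ?_⟩
      have hk : (q k : ℝ) ≠ 0 := by exact_mod_cast (hq.pos k).ne'
      rw [Int.cast_natCast, div_self hk, sub_self, abs_zero]
      exact (hε0 k).le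
    · obtain ⟨h0, h1⟩ := hq.digitSum_mem_Icc a
      refine hsmooth _ (by rwa [abs_of_nonneg h0]) fun k => ?_
      obtain ⟨p, hp0, hp1⟩ := hq.exists_approx a k
      exact ⟨p, by rw [abs_of_pos hp0]; exact hp1.trans (hqε k)⟩
  refine ⟨blockField E q α l, chartFlow (blockChart E q α l), range (digitSum q),
    h.contDiff_blockField.contDiffOn, fun x hx => ⟨fun hx0 => ?_, ?_⟩, hT.isFlowOf hξ0,
    range_nonempty _, isCompact_range hq.continuous_digitSum, hq.perfect_range_digitSum,
    hq.isTotallyDisconnected_range_digitSum, ?_, h.not_contDiffWithinAt_flow_half hodd,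
    fun t ht => ?_⟩
  · by_contra hne
    exact (hT.pos x (lt_of_le_of_ne hx (Ne.symm hne))).ne' hx0
  · rintro rfl
    exact hξ0
  · rintro _ ⟨a, rfl⟩
    exact hq.irrational_digitSum a
  · obtain ⟨h1, h2⟩ := hT.contDiff_flow_of_mem_closure hgen ht
    exact hT.crHalfLineDiffeo h1 h2
end

section
/- For all k ≥ 1 let q_k be an odd positive integer, j_k an integer, and w_k > 0 a real number with w_k · q_k · ‖γ‖₁ < 1. Define γ_k(t) = w_k·γ(q_k(t - j_k)), φ_k(t) = t + Σ_{p≥0} γ_k(t + p/q_k) (for each t at most one summand is nonzero), and Φ_k = φ_k ∘ φ_{k-1} ∘ ⋯ ∘ φ_1, with Φ_0 = id. Then each φ_k is a C^∞ diffeomorphism of ℝ and for every k ≥ 1: (a) Φ_k coincides with the identity in a neighbourhood of ℤ + 1/2; (b) Φ_k is tangent to the identity on ℤ, i.e. Φ_k(l) = l and DΦ_k(l) = 1 for all l ∈ ℤ; (c) for every l ∈ ℤ, (LΦ_k − LΦ_{k-1})(l) equals w_k·q_k² if l ≤ j_k, and equals 0 if l > j_k. -/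
open Set Filter Topology

/-- The one-sided periodization `s ↦ ∑_{p ≥ 0} f (s + p)`. -/
noncomputable def halfPeriodization (f : ℝ → ℝ) (s : ℝ) : ℝ := ∑' p : ℕ, f (s + p)

section HalfPeriodization

variable {f : ℝ → ℝ}

theorem subsingleton_translates_ne_zero
    (hf : ∀ t : ℝ, t ∉ Set.Icc (-(1 / 4) : ℝ) (1 / 4) → f t = 0) (s : ℝ) :
    {p : ℕ | f (s + p) ≠ 0}.Subsingleton := by
  intro a ha b hb
  have ha' : s + a ∈ Set.Icc (-(1 / 4) : ℝ) (1 / 4) := not_not.mp (mt (hf _) ha)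
  have hb' : s + b ∈ Set.Icc (-(1 / 4) : ℝ) (1 / 4) := not_not.mp (mt (hf _) hb)
  have h1 : (a : ℝ) < b + 1 := by linarith [ha'.2, hb'.1]
  have h2 : (b : ℝ) < a + 1 := by linarith [hb'.2, ha'.1]
  norm_cast at h1 h2
  omega

theorem halfPeriodization_eq_of_abs_sub_lt
    (hf : ∀ t : ℝ, t ∉ Set.Icc (-(1 / 4) : ℝ) (1 / 4) → f t = 0) {s : ℝ} {n : ℤ}
    (hs : |s - n| < 3 / 4) :
    halfPeriodization f s = if n ≤ 0 then f (s - n) else 0 := by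
  obtain ⟨hs1, hs2⟩ := abs_lt.mp hs
  have key : ∀ p : ℕ, n + p ≠ 0 → f (s + p) = 0 := by
    intro p hp
    refine hf _ fun h => ?_
    rcases lt_or_gt_of_ne hp with h0 | h0
    · have : (n : ℝ) + p ≤ -1 := by exact_mod_cast (by omega : n + p ≤ -1)
      linarith [h.1]
    · have : (1 : ℝ) ≤ (n : ℝ) + p := by exact_mod_cast (by omega : 1 ≤ n + p)
      linarith [h.2]
  unfold halfPeriodization
  split_ifs with hn
  · obtain ⟨m, hm⟩ := Int.eq_ofNat_of_zero_le (neg_nonneg.mpr hn)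
    rw [tsum_eq_single m fun p hp => key p (by omega)]
    have : (n : ℝ) = -m := by exact_mod_cast (by omega : n = -m)
    rw [this, sub_neg_eq_add]
  · rw [tsum_congr fun p => key p (by omega), tsum_zero]

theorem halfPeriodization_eventuallyEq
    (hf : ∀ t : ℝ, t ∉ Set.Icc (-(1 / 4) : ℝ) (1 / 4) → f t = 0) {s : ℝ} {n : ℤ}
    (hs : |s - n| < 3 / 4) :
    halfPeriodization f =ᶠ[𝓝 s] fun x => if n ≤ 0 then f (x - n) else 0 := by
  have ho : IsOpen {x : ℝ | |x - n| < 3 / 4} := isOpen_lt (by fun_prop) continuous_const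
  filter_upwards [ho.mem_nhds hs] with x hx
  exact halfPeriodization_eq_of_abs_sub_lt hf hx

theorem abs_sub_round_lt (s : ℝ) : |s - round s| < 3 / 4 :=
  (abs_sub_round s).trans_lt (by norm_num)

theorem contDiff_halfPeriodization {m : WithTop ℕ∞} (hsm : ContDiff ℝ m f)
    (hf : ∀ t : ℝ, t ∉ Set.Icc (-(1 / 4) : ℝ) (1 / 4) → f t = 0) :
    ContDiff ℝ m (halfPeriodization f) := by
  refine contDiff_iff_contDiffAt.mpr fun s => ?_
  refine ContDiffAt.congr_of_eventuallyEq ?_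
    (halfPeriodization_eventuallyEq hf (abs_sub_round_lt s))
  split_ifs
  · exact (hsm.comp (contDiff_id.sub contDiff_const)).contDiffAt
  · exact contDiffAt_const

theorem halfPeriodization_mem_Icc (hr : ∀ t : ℝ, f t ∈ Set.Icc (0 : ℝ) 1)
    (hf : ∀ t : ℝ, t ∉ Set.Icc (-(1 / 4) : ℝ) (1 / 4) → f t = 0) (s : ℝ) :
    halfPeriodization f s ∈ Set.Icc (0 : ℝ) 1 := by
  rw [halfPeriodization_eq_of_abs_sub_lt hf (abs_sub_round_lt s)]
  split_ifs
  · exact hr _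
  · simp

theorem abs_deriv_halfPeriodization_le {M : ℝ} (hM : ∀ t, |deriv f t| ≤ M)
    (hf : ∀ t : ℝ, t ∉ Set.Icc (-(1 / 4) : ℝ) (1 / 4) → f t = 0) (s : ℝ) :
    |deriv (halfPeriodization f) s| ≤ M := by
  rw [(halfPeriodization_eventuallyEq hf (abs_sub_round_lt s)).deriv_eq]
  split_ifs
  · rw [deriv_comp_sub_const]
    exact hM _
  · simpa using (abs_nonneg _).trans (hM 0)

theorem halfPeriodization_eventuallyEq_zero
    (hf : ∀ t : ℝ, t ∉ Set.Icc (-(1 / 4) : ℝ) (1 / 4) → f t = 0) (n : ℤ) :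
    ∀ᶠ s in 𝓝 ((n : ℝ) + 1 / 2), halfPeriodization f s = 0 := by
  filter_upwards [Ioo_mem_nhds (by linarith : (n : ℝ) + 1 / 4 < n + 1 / 2)
    (by linarith : (n : ℝ) + 1 / 2 < n + 3 / 4)] with s hs
  rw [halfPeriodization_eq_of_abs_sub_lt hf
    (abs_lt.mpr ⟨by linarith [hs.1], by linarith [hs.2]⟩ : |s - n| < 3 / 4)]
  split_ifs
  · exact hf _ fun h => by linarith [h.2, hs.1]
  · rfl

theorem halfPeriodization_eventuallyEq_sq
    (hf : ∀ t : ℝ, t ∉ Set.Icc (-(1 / 4) : ℝ) (1 / 4) → f t = 0)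
    (h0 : ∀ᶠ t in 𝓝 (0 : ℝ), f t = t ^ 2 / 2) (n : ℤ) :
    ∀ᶠ s in 𝓝 (n : ℝ), halfPeriodization f s = if n ≤ 0 then (s - n) ^ 2 / 2 else 0 := by
  have ht : Tendsto (fun s : ℝ => s - n) (𝓝 (n : ℝ)) (𝓝 0) := by
    have : Continuous fun s : ℝ => s - n := by fun_prop
    simpa using this.tendsto (n : ℝ)
  filter_upwards [ht.eventually h0,
    halfPeriodization_eventuallyEq hf (by simp : |(n : ℝ) - n| < 3 / 4)] with s h1 h2
  rw [h2, h1]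

end HalfPeriodization

theorem bddAbove_abs_iteratedDeriv_le {f : ℝ → ℝ} {m : ℕ} (hf : ContDiff ℝ m f)
    (hc : HasCompactSupport f) :
    BddAbove {y : ℝ | ∃ i ≤ m, ∃ t : ℝ, y = |iteratedDeriv i f t|} := by
  have hb : ∀ i : ℕ, ∃ C, i ≤ m → ∀ t, |iteratedDeriv i f t| ≤ C := by
    intro i
    by_cases hi : i ≤ m
    · have hcont : Continuous (iteratedFDeriv ℝ i f) :=
        hf.continuous_iteratedFDeriv (by exact_mod_cast hi)
      obtain ⟨C, hC⟩ := hcont.bounded_above_of_compact_support (hc.iteratedFDeriv i)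
      refine ⟨C, fun _ t => ?_⟩
      rw [← Real.norm_eq_abs, ← norm_iteratedFDeriv_eq_norm_iteratedDeriv]
      exact hC t
    · exact ⟨0, fun h => absurd h hi⟩
  choose C hC using hb
  refine ⟨∑ i ∈ Finset.range (m + 1), |C i|, ?_⟩
  rintro _ ⟨i, hi, t, rfl⟩
  exact ((hC i hi t).trans (le_abs_self _)).trans
    (Finset.single_le_sum (f := fun i => |C i|) (fun _ _ => abs_nonneg _)
      (Finset.mem_range.mpr (by omega)))

theorem abs_deriv_le_sSup {f : ℝ → ℝ} (hf : ContDiff ℝ 1 f) (hc : HasCompactSupport f) (t : ℝ) :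
    |deriv f t| ≤ sSup {y : ℝ | ∃ i ≤ 1, ∃ t : ℝ, y = |iteratedDeriv i f t|} :=
  le_csSup (bddAbove_abs_iteratedDeriv_le (by exact_mod_cast hf) hc)
    ⟨1, le_rfl, t, by rw [iteratedDeriv_one]⟩

theorem bijective_of_deriv_pos_of_bounded_sub_id {f : ℝ → ℝ} (hf : Continuous f)
    (hd : ∀ t, 0 < deriv f t) {C : ℝ} (hC : ∀ t, |f t - t| ≤ C) : Function.Bijective f := by
  refine ⟨(strictMono_of_deriv_pos hd).injective, hf.surjective ?_ ?_⟩
  · refine tendsto_atTop_mono (fun t => ?_) (tendsto_atTop_add_const_right _ (-C) tendsto_id)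
    have := (abs_le.mp (hC t)).1
    simp only [id]
    linarith
  · refine tendsto_atBot_mono (fun t => ?_) (tendsto_atBot_add_const_right _ C tendsto_id)
    have := (abs_le.mp (hC t)).2
    simp only [id]
    linarith

theorem derivs_of_eventuallyEq_add_sq {f : ℝ → ℝ} {x c : ℝ}
    (h : ∀ᶠ t in 𝓝 x, f t = t + c * ((t - x) ^ 2 / 2)) :
    f x = x ∧ deriv f x = 1 ∧ deriv (deriv f) x = c := by
  have hd : ∀ t, HasDerivAt (fun t : ℝ => t + c * ((t - x) ^ 2 / 2)) (1 + c * (t - x)) t := by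
    intro t
    have h1 := (((hasDerivAt_id t).sub_const x).pow 2).div_const 2
    refine ((hasDerivAt_id t).add (h1.const_mul c)).congr_deriv ?_
    simp
  have h' : deriv f =ᶠ[𝓝 x] fun t => 1 + c * (t - x) := by
    have h0 : f =ᶠ[𝓝 x] fun t => t + c * ((t - x) ^ 2 / 2) := h
    filter_upwards [h0.deriv] with t ht
    rw [ht, (hd t).deriv]
  refine ⟨by simpa using h.self_of_nhds, by simpa using h'.self_of_nhds, ?_⟩
  rw [h'.deriv_eq]
  simp

theorem deriv_deriv_comp {g f : ℝ → ℝ} (hg : ContDiff ℝ 2 g) (hf : ContDiff ℝ 2 f) (x : ℝ) :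
    deriv (deriv (g ∘ f)) x =
      deriv (deriv g) (f x) * deriv f x ^ 2 + deriv g (f x) * deriv (deriv f) x := by
  have hg1 : Differentiable ℝ g := hg.differentiable (by norm_num)
  have hf1 : Differentiable ℝ f := hf.differentiable (by norm_num)
  have hg2 : Differentiable ℝ (deriv g) := hg.differentiable_deriv_two
  have hf2 : Differentiable ℝ (deriv f) := hf.differentiable_deriv_two
  have h : deriv (g ∘ f) = fun t => deriv g (f t) * deriv f t :=
    funext fun t => deriv_comp t (hg1 _) (hf1 t)
  rw [h]
  have h1 : HasDerivAt (fun t => deriv g (f t)) (deriv (deriv g) (f x) * deriv f x) x :=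
    (hg2 (f x)).hasDerivAt.comp x (hf1 x).hasDerivAt
  have h2 := h1.fun_mul (hf2 x).hasDerivAt
  rw [h2.deriv]
  ring

section Perturbation

variable {γ : ℝ → ℝ} {q : ℕ} {j : ℤ} {w : ℝ}

theorem tendsto_affine_rescaling {x y : ℝ} (h : (q : ℝ) * (x - j) = y) :
    Tendsto (fun t : ℝ => (q : ℝ) * (t - j)) (𝓝 x) (𝓝 y) := by
  have : Continuous fun t : ℝ => (q : ℝ) * (t - j) := by fun_prop
  exact h ▸ this.tendsto x

theorem deriv_perturbation_pos (hγ : ContDiff ℝ 1 γ)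
    (hsupp : ∀ t : ℝ, t ∉ Set.Icc (-(1 / 4) : ℝ) (1 / 4) → γ t = 0) (hw : 0 ≤ w) {M : ℝ}
    (hM : ∀ t, |deriv γ t| ≤ M) (hsmall : w * q * M < 1) (t : ℝ) :
    0 < deriv (fun t => t + w * halfPeriodization γ (q * (t - j))) t := by
  have hS : Differentiable ℝ (halfPeriodization γ) :=
    (contDiff_halfPeriodization hγ hsupp).differentiable one_ne_zero
  have h1 : HasDerivAt (fun t : ℝ => (q : ℝ) * (t - j)) q t := by
    simpa using ((hasDerivAt_id t).sub_const (j : ℝ)).const_mul (q : ℝ)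
  have h2 := (hasDerivAt_id t).add (((hS _).hasDerivAt.comp t h1).const_mul w)
  have h3 : deriv (fun t => t + w * halfPeriodization γ (q * (t - j))) t =
      1 + w * (deriv (halfPeriodization γ) (q * (t - j)) * q) := h2.deriv
  rw [h3]
  have h4 := (abs_le.mp
    (abs_deriv_halfPeriodization_le hM hsupp ((q : ℝ) * (t - j)))).1
  have h5 := mul_le_mul_of_nonneg_left h4 (mul_nonneg hw (Nat.cast_nonneg (α := ℝ) q))
  linarith

theorem perturbation_eventuallyEq_id (hq : Odd q)
    (hsupp : ∀ t : ℝ, t ∉ Set.Icc (-(1 / 4) : ℝ) (1 / 4) → γ t = 0) (l : ℤ) :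
    ∀ᶠ t in 𝓝 ((l : ℝ) + 1 / 2), t + w * halfPeriodization γ (q * (t - j)) = t := by
  obtain ⟨r, hr⟩ := hq
  have h : (q : ℝ) * ((l : ℝ) + 1 / 2 - j) = ((q * (l - j) + r : ℤ) : ℝ) + 1 / 2 := by
    have : (q : ℝ) = 2 * r + 1 := by exact_mod_cast hr
    push_cast
    rw [this]
    ring
  filter_upwards [(tendsto_affine_rescaling h).eventually
    (halfPeriodization_eventuallyEq_zero hsupp _)] with t ht
  rw [ht, mul_zero, add_zero]

theorem perturbation_eventuallyEq_add_sq (hq : 0 < q)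
    (hsupp : ∀ t : ℝ, t ∉ Set.Icc (-(1 / 4) : ℝ) (1 / 4) → γ t = 0)
    (h0 : ∀ᶠ t in 𝓝 (0 : ℝ), γ t = t ^ 2 / 2) (l : ℤ) :
    ∀ᶠ t in 𝓝 (l : ℝ), t + w * halfPeriodization γ (q * (t - j)) =
      t + (if l ≤ j then w * (q : ℝ) ^ 2 else 0) * ((t - l) ^ 2 / 2) := by
  have h : (q : ℝ) * ((l : ℝ) - j) = ((q * (l - j) : ℤ) : ℝ) := by push_cast; ring
  have hq' : (0 : ℤ) < q := by exact_mod_cast hq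
  have hiff : (q : ℤ) * (l - j) ≤ 0 ↔ l ≤ j := by
    rw [← sub_nonpos (a := l)]
    exact ⟨fun h => nonpos_of_mul_nonpos_right h hq', fun h =>
      mul_nonpos_of_nonneg_of_nonpos hq'.le h⟩
  filter_upwards [(tendsto_affine_rescaling h).eventually
    (halfPeriodization_eventuallyEq_sq hsupp h0 _)] with t ht
  rw [ht]
  simp only [hiff]
  split_ifs
  · push_cast
    ring
  · ring

end Perturbation

/-- Lemma on the perturbation diffeomorphisms `Φ_k = φ_k ∘ ⋯ ∘ φ_1`, where
`φ_k(t) = t + Σ_{p≥0} γ_k(t + p/q_k)` and `γ_k(t) = w_k·γ(q_k(t − j_k))`: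
each `φ_k` is a smooth diffeomorphism of `ℝ`, `Φ_k` is the identity near `ℤ + 1/2`,
is tangent to the identity on `ℤ`, and `(LΦ_k − LΦ_{k−1})(l)` equals `w_k q_k²` for
`l ≤ j_k` and `0` for `l > j_k`, where `Lg = D²g/Dg`. -/
theorem statement2
    (γ : ℝ → ℝ) (hγ_smooth : ContDiff ℝ ((⊤ : ℕ∞) : WithTop ℕ∞) γ)
    (hγ_range : ∀ t : ℝ, γ t ∈ Set.Icc (0 : ℝ) 1)
    (hγ_supp : ∀ t : ℝ, t ∉ Set.Icc (-(1 / 4) : ℝ) (1 / 4) → γ t = 0)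
    (hγ_zero : ∀ᶠ t in 𝓝 (0 : ℝ), γ t = t ^ 2 / 2)
    (q : ℕ → ℕ) (j : ℕ → ℤ) (w : ℕ → ℝ)
    (hq_odd : ∀ k, 1 ≤ k → Odd (q k)) (hq_pos : ∀ k, 1 ≤ k → 0 < q k)
    (hw_pos : ∀ k, 1 ≤ k → 0 < w k)
    (hsmall : ∀ k, 1 ≤ k →
      w k * (q k : ℝ) * sSup {y : ℝ | ∃ i ≤ 1, ∃ t : ℝ, y = |iteratedDeriv i γ t|} < 1)
    (γk φ Φ : ℕ → ℝ → ℝ)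
    (hγk : ∀ k t, γk k t = w k * γ ((q k : ℝ) * (t - (j k : ℝ))))
    (hφ : ∀ k t, φ k t = t + ∑' p : ℕ, γk k (t + (p : ℝ) / (q k : ℝ)))
    (hΦ0 : Φ 0 = id)
    (hΦ : ∀ k, Φ (k + 1) = φ (k + 1) ∘ Φ k) :
    ∀ k, 1 ≤ k →
      -- for each `t`, at most one summand in the series defining `φ_k` is nonzero
      (∀ t : ℝ, {p : ℕ | γk k (t + (p : ℝ) / (q k : ℝ)) ≠ 0}.Subsingleton) ∧
      -- each `φ_k` is a smooth diffeomorphism of `ℝ`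
      (ContDiff ℝ ((⊤ : ℕ∞) : WithTop ℕ∞) (φ k) ∧ Function.Bijective (φ k) ∧
        ∀ t : ℝ, 0 < deriv (φ k) t) ∧
      -- (a) `Φ_k` is the identity in a neighbourhood of `ℤ + 1/2`
      (∀ l : ℤ, ∀ᶠ t in 𝓝 ((l : ℝ) + 1 / 2), Φ k t = t) ∧
      -- (b) `Φ_k` is tangent to the identity on `ℤ`
      (∀ l : ℤ, Φ k (l : ℝ) = (l : ℝ) ∧ deriv (Φ k) (l : ℝ) = 1) ∧
      -- (c) the jump of `LΦ` at integers
      (∀ l : ℤ,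
        deriv (deriv (Φ k)) (l : ℝ) / deriv (Φ k) (l : ℝ) -
            deriv (deriv (Φ (k - 1))) (l : ℝ) / deriv (Φ (k - 1)) (l : ℝ) =
          if l ≤ j k then w k * (q k : ℝ) ^ 2 else 0) := by
  have hc : HasCompactSupport γ :=
    HasCompactSupport.intro isCompact_Icc fun t ht => hγ_supp t ht
  have hγ1 : ContDiff ℝ 1 γ := hγ_smooth.of_le (by exact_mod_cast le_top)
  have hterm : ∀ k, 1 ≤ k → ∀ (t : ℝ) (p : ℕ), γk k (t + (p : ℝ) / (q k : ℝ)) =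
      w k * γ ((q k : ℝ) * (t - j k) + p) := by
    intro k hk t p
    have : (q k : ℝ) ≠ 0 := by exact_mod_cast (hq_pos k hk).ne'
    rw [hγk]
    congr 2
    field_simp
    ring
  have hφ_eq : ∀ k, 1 ≤ k →
      φ k = fun t => t + w k * halfPeriodization γ ((q k : ℝ) * (t - j k)) := by
    intro k hk
    funext t
    rw [hφ, tsum_congr (hterm k hk t), tsum_mul_left, halfPeriodization]
  have hφ_smooth : ∀ k, 1 ≤ k → ContDiff ℝ ((⊤ : ℕ∞) : WithTop ℕ∞) (φ k) := by
    intro k hk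
    rw [hφ_eq k hk]
    exact contDiff_id.add (contDiff_const.mul ((contDiff_halfPeriodization hγ_smooth hγ_supp).comp
      (contDiff_const.mul (contDiff_id.sub contDiff_const))))
  have hφ_half : ∀ k, 1 ≤ k → ∀ l : ℤ, ∀ᶠ t in 𝓝 ((l : ℝ) + 1 / 2), φ k t = t := by
    intro k hk l
    rw [hφ_eq k hk]
    exact perturbation_eventuallyEq_id (hq_odd k hk) hγ_supp l
  have hφ_int : ∀ k, 1 ≤ k → ∀ l : ℤ, φ k l = l ∧ deriv (φ k) l = 1 ∧
      deriv (deriv (φ k)) l = if l ≤ j k then w k * (q k : ℝ) ^ 2 else 0 := by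
    intro k hk l
    rw [hφ_eq k hk]
    exact derivs_of_eventuallyEq_add_sq
      (perturbation_eventuallyEq_add_sq (hq_pos k hk) hγ_supp hγ_zero l)
  have hΦ_smooth : ∀ k, ContDiff ℝ ((⊤ : ℕ∞) : WithTop ℕ∞) (Φ k) := by
    intro k
    induction k with
    | zero => rw [hΦ0]; exact contDiff_id
    | succ k ih => rw [hΦ]; exact (hφ_smooth _ (by omega)).comp ih
  have hΦ_half : ∀ k, ∀ l : ℤ, ∀ᶠ t in 𝓝 ((l : ℝ) + 1 / 2), Φ k t = t := by
    intro k l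
    induction k with
    | zero => simp [hΦ0]
    | succ k ih =>
      filter_upwards [ih, hφ_half (k + 1) (by omega) l] with t h1 h2
      rw [hΦ, Function.comp_apply, h1, h2]
  have htop : (1 : WithTop ℕ∞) ≤ ((⊤ : ℕ∞) : WithTop ℕ∞) := by exact_mod_cast le_top
  have hΦ_int : ∀ k, ∀ l : ℤ, Φ k l = l ∧ deriv (Φ k) l = 1 := by
    intro k l
    induction k with
    | zero => simp [hΦ0]
    | succ k ih =>
      obtain ⟨h1, h2, -⟩ := hφ_int (k + 1) (by omega) l
      refine ⟨by rw [hΦ, Function.comp_apply, ih.1, h1], ?_⟩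
      rw [hΦ, deriv_comp _ (((hφ_smooth (k + 1) (by omega)).of_le htop).differentiable
        one_ne_zero _) (((hΦ_smooth k).of_le htop).differentiable one_ne_zero _),
        ih.1, h2, ih.2, one_mul]
  intro k hk
  refine ⟨fun t => ?_, ⟨hφ_smooth k hk, ?_⟩, hΦ_half k, hΦ_int k, fun l => ?_⟩
  · refine (subsingleton_translates_ne_zero hγ_supp ((q k : ℝ) * (t - j k))).anti fun p hp => ?_
    rw [Set.mem_ofPred_eq, hterm k hk t p] at hp
    exact right_ne_zero_of_mul hp
  · have hpos : ∀ t, 0 < deriv (φ k) t := by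
      rw [hφ_eq k hk]
      exact deriv_perturbation_pos hγ1 hγ_supp (hw_pos k hk).le (abs_deriv_le_sSup hγ1 hc)
        (hsmall k hk)
    refine ⟨bijective_of_deriv_pos_of_bounded_sub_id (hφ_smooth k hk).continuous hpos
      (C := w k) fun t => ?_, hpos⟩
    have hS := halfPeriodization_mem_Icc hγ_range hγ_supp ((q k : ℝ) * (t - j k))
    rw [hφ_eq k hk, add_sub_cancel_left, abs_of_nonneg (mul_nonneg (hw_pos k hk).le hS.1)]
    exact mul_le_of_le_one_right (hw_pos k hk).le hS.2
  · obtain ⟨k, rfl⟩ := Nat.exists_eq_add_of_le' hk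
    have htwo : (2 : WithTop ℕ∞) ≤ ((⊤ : ℕ∞) : WithTop ℕ∞) :=
      WithTop.coe_le_coe.mpr (le_top : (2 : ℕ∞) ≤ ⊤)
    obtain ⟨-, h1, h2⟩ := hφ_int (k + 1) hk l
    rw [Nat.add_sub_cancel, (hΦ_int (k + 1) l).2, (hΦ_int k l).2, hΦ,
      deriv_deriv_comp ((hφ_smooth _ hk).of_le htwo) ((hΦ_smooth k).of_le htwo),
      (hΦ_int k l).1, (hΦ_int k l).2, h1, h2]
    ring
end
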